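/- Fix A > 0. For X ≥ 2 set ρ = e^{−1/X} and define Φ(z) = Σ_{j≥1} (1/j) Σ_{p₁,p₂ prime} z^{p₁p₂j}. Then for every α ∈ ℝ with |α| ≤ X^{−1}(log X)^A, Φ(ρ·e(α)) = 2ζ(2) · X·(log log X) / ((1 − 2πiαX)·log X) + O( X·(log log log log X)/(log X) ), with implied constant depending only on A. -/

import Mathlib

open Filter Real Topology

noncomputable section

/-- `e(t) = exp(2πit)`. -/
def eC (t : ℝ) : ℂ := Complex.exp (2 * Real.pi * Complex.I * t)

/-- `ζ(2)` as a real number. -/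
def zeta2 : ℝ := (riemannZeta 2).re

/-- `Φ(z) = Σ_{j ≥ 1} (1/j) Σ_{p₁, p₂ prime} z^{p₁p₂j}`. -/
def PhiP2C (z : ℂ) : ℂ :=
  ∑' (j : ℕ+) (p : Nat.Primes) (q : Nat.Primes),
    (1 / (j : ℂ)) * z ^ ((p : ℕ) * (q : ℕ) * (j : ℕ))

open MeasureTheory FourierTransform SchwartzMap in
/-- The `L²` norm of an integrable, square-integrable function is at most that of its Fourier
transform. -/
theorem eLpNorm_two_le_eLpNorm_fourier {f : ℝ → ℂ} (hf : Integrable f) (hf2 : MemLp f 2)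
    (hF : MemLp (𝓕 f) 2) : eLpNorm f 2 ≤ eLpNorm (𝓕 f) 2 := by
  have key : ∀ ψ : Lp (α := ℝ) ℂ 2, ‖inner ℂ (hf2.toLp f) ψ‖ ≤ ‖hF.toLp (𝓕 f)‖ * ‖ψ‖ := by
    intro ψ
    refine DenseRange.induction_on
      (p := fun ψ : Lp (α := ℝ) ℂ 2 ↦
        ‖inner ℂ (hf2.toLp f) ψ‖ ≤ ‖hF.toLp (𝓕 f)‖ * ‖ψ‖)
      (SchwartzMap.denseRange_toLpCLM (p := 2) (μ := volume) ENNReal.ofNat_ne_top) ψ ?_ ?_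
    · exact isClosed_le (by fun_prop) (by fun_prop)
    · intro φ
      change ‖inner ℂ (hf2.toLp f) (φ.toLp 2)‖ ≤ ‖hF.toLp (𝓕 f)‖ * ‖φ.toLp 2‖
      have e1 : inner ℂ (hf2.toLp f) (φ.toLp 2) = inner ℂ (hF.toLp (𝓕 f)) ((𝓕 φ).toLp 2) := by
        rw [L2.inner_def, L2.inner_def]
        calc _ = ∫ x, inner ℂ (f x) (φ x) := by
              refine integral_congr_ae ?_
              filter_upwards [hf2.coeFn_toLp, φ.coeFn_toLp 2] with x h1 h2
              rw [h1, h2]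
          _ = ∫ x, inner ℂ (𝓕 f x) (𝓕 φ x) := by
              have := VectorFourier.integral_sesq_fourierIntegral_eq_neg_flip
                (innerSL ℂ (E := ℂ)) (L := innerₗ ℝ) continuous_fourierChar continuous_inner hf
                  ((𝓕 φ).integrable (μ := volume))
              have h2 : 𝓕⁻ (𝓕 φ) = φ := FourierTransform.fourierInv_fourier_eq φ
              symm
              convert! this using 1
              congr 1
              ext x
              conv_lhs => rw [← h2, fourierInv_coe]
              simp [FourierTransformInv.fourierInv]
          _ = _ := by
              refine integral_congr_ae ?_
              filter_upwards [hF.coeFn_toLp, (𝓕 φ).coeFn_toLp 2] with x h1 h2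
              rw [h1, h2]
      rw [e1, ← norm_fourier_toL2_eq φ]
      exact norm_inner_le_norm _ _
  have h := key (hf2.toLp f)
  rw [inner_self_eq_norm_sq_to_K, norm_pow, RCLike.norm_ofReal, abs_norm, sq] at h
  have h' : ‖hf2.toLp f‖ ≤ ‖hF.toLp (𝓕 f)‖ := by
    rcases (norm_nonneg (hf2.toLp f)).eq_or_lt with h0 | h0
    · rw [← h0]; positivity
    · exact le_of_mul_le_mul_right h h0
  rw [Lp.norm_toLp, Lp.norm_toLp] at h'
  exact (ENNReal.toReal_le_toReal hf2.2.ne hF.2.ne).1 h'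

/-- The `n`-th summand of the Euler–Maclaurin expansion of `(s - 1) ζ(s)`. -/
def zetaTerm (n : ℕ) (s : ℂ) : ℂ :=
  (s - 1) * ((n + 2 : ℕ) : ℂ) ^ (-s) + ((n + 2 : ℕ) : ℂ) ^ (1 - s) - ((n + 1 : ℕ) : ℂ) ^ (1 - s)

theorem differentiable_zetaTerm (n : ℕ) : Differentiable ℂ (zetaTerm n) := by
  have h1 : ((n + 1 : ℕ) : ℂ) ≠ 0 := by exact_mod_cast Nat.succ_ne_zero n
  have h2 : ((n + 2 : ℕ) : ℂ) ≠ 0 := by exact_mod_cast Nat.succ_ne_zero (n + 1)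
  unfold zetaTerm
  intro s
  refine ((DifferentiableAt.mul (by fun_prop) ?_).add ?_).sub ?_
  · exact (differentiableAt_id.neg).const_cpow (Or.inl h2)
  · exact (differentiableAt_id.const_sub 1).const_cpow (Or.inl h2)
  · exact (differentiableAt_id.const_sub 1).const_cpow (Or.inl h1)

theorem hasDerivAt_ofReal_cpow_neg {x : ℝ} (hx : 0 < x) (s : ℂ) :
    HasDerivAt (fun y : ℝ ↦ (y : ℂ) ^ (-s)) (-s * (x : ℂ) ^ (-s - 1)) x := by
  by_cases hs : s = 0
  · subst hs
    simpa using hasDerivAt_const x (1 : ℂ)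
  exact hasDerivAt_ofReal_cpow_const hx.ne' (neg_ne_zero.2 hs)

theorem norm_cpow_neg_sub_cpow_neg_le {a x : ℝ} (ha : 0 < a) (hx : x ∈ Set.Icc a (a + 1)) {s : ℂ}
    (hs : 0 ≤ s.re) :
    ‖((a + 1 : ℝ) : ℂ) ^ (-s) - (x : ℂ) ^ (-s)‖ ≤ ‖s‖ * a ^ (-s.re - 1) := by
  have := (convex_Icc a (a + 1)).norm_image_sub_le_of_norm_hasDerivWithin_le
    (f := fun y : ℝ ↦ (y : ℂ) ^ (-s)) (f' := fun y ↦ -s * (y : ℂ) ^ (-s - 1))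
    (C := ‖s‖ * a ^ (-s.re - 1)) (x := x) (y := a + 1)
    (fun y hy ↦ (hasDerivAt_ofReal_cpow_neg (ha.trans_le hy.1) s).hasDerivWithinAt)
    (fun y hy ↦ by
      rw [norm_mul, norm_neg, Complex.norm_cpow_eq_rpow_re_of_pos (ha.trans_le hy.1)]
      gcongr
      simp only [Complex.sub_re, Complex.neg_re, Complex.one_re]
      exact Real.rpow_le_rpow_of_nonpos ha hy.1 (by linarith))
    hx ⟨by linarith, le_rfl⟩
  refine this.trans ?_
  have h1 : ‖a + 1 - x‖ ≤ 1 := by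
    rw [Real.norm_eq_abs, abs_le]; constructor <;> linarith [hx.1, hx.2]
  calc _ ≤ ‖s‖ * a ^ (-s.re - 1) * 1 := by gcongr
    _ = _ := by ring

theorem norm_cpow_neg_sub_cpow_neg_le_two {a x : ℝ} (ha : 0 < a) (hx : x ∈ Set.Icc a (a + 1))
    {s : ℂ} (hs : 0 ≤ s.re) :
    ‖((a + 1 : ℝ) : ℂ) ^ (-s) - (x : ℂ) ^ (-s)‖ ≤ 2 * a ^ (-s.re) := by
  refine (norm_sub_le _ _).trans ?_
  rw [Complex.norm_cpow_eq_rpow_re_of_pos (ha.trans_le hx.1),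
    Complex.norm_cpow_eq_rpow_re_of_pos (by linarith : 0 < a + 1), Complex.neg_re]
  have h1 := Real.rpow_le_rpow_of_nonpos ha hx.1 (by linarith : -s.re ≤ 0)
  have h2 := Real.rpow_le_rpow_of_nonpos ha (by linarith : a ≤ a + 1) (by linarith : -s.re ≤ 0)
  linarith

theorem norm_zetaTerm_le_of_forall {n : ℕ} {s : ℂ} {C : ℝ}
    (h : ∀ x ∈ Set.Icc (n + 1 : ℝ) (n + 1 + 1),
      ‖((n + 1 + 1 : ℝ) : ℂ) ^ (-s) - (x : ℂ) ^ (-s)‖ ≤ C) :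
    ‖zetaTerm n s‖ ≤ ‖s - 1‖ * C := by
  have hn : (0 : ℝ) < n + 1 := by positivity
  have := (convex_Icc (n + 1 : ℝ) (n + 1 + 1)).norm_image_sub_le_of_norm_hasDerivWithin_le
    (f := fun y : ℝ ↦ (s - 1) * ((n + 1 + 1 : ℝ) : ℂ) ^ (-s) * (y : ℂ) + (y : ℂ) ^ (-(s - 1)))
    (f' := fun y ↦ (s - 1) * (((n + 1 + 1 : ℝ) : ℂ) ^ (-s) - (y : ℂ) ^ (-s)))
    (C := ‖s - 1‖ * C) (x := n + 1) (y := n + 1 + 1)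
    (fun y hy ↦ by
      have h1 := (hasDerivAt_ofReal_cpow_neg (hn.trans_le hy.1) (s - 1))
      have h2 := ((hasDerivAt_id y).ofReal_comp.const_mul
        ((s - 1) * ((n + 1 + 1 : ℝ) : ℂ) ^ (-s)))
      refine ((h2.add h1).congr_deriv ?_).hasDerivWithinAt
      rw [show -(s - 1) - 1 = -s by ring]
      push_cast
      ring)
    (fun y hy ↦ by
      rw [norm_mul]
      gcongr
      exact h y hy)
    ⟨le_rfl, by linarith⟩ ⟨by linarith, le_rfl⟩
  convert! this using 1
  · congr 1
    unfold zetaTerm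
    push_cast
    rw [show -(s - 1) = 1 - s by ring, show (n : ℂ) + 1 + 1 = n + 2 by ring]
    ring
  · simp

theorem norm_zetaTerm_le (n : ℕ) {s : ℂ} (hs : 0 ≤ s.re) :
    ‖zetaTerm n s‖ ≤ ‖s - 1‖ * (‖s‖ * (n + 1 : ℝ) ^ (-s.re - 1)) :=
  norm_zetaTerm_le_of_forall fun _ hx ↦
    norm_cpow_neg_sub_cpow_neg_le (by positivity) hx hs

theorem norm_zetaTerm_le_rpow (n : ℕ) {s : ℂ} (hs : 0 ≤ s.re) {θ : ℝ} (h0 : 0 ≤ θ) (h1 : θ ≤ 1) :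
    ‖zetaTerm n s‖ ≤ ‖s - 1‖ * (2 * ‖s‖ ^ θ * (n + 1 : ℝ) ^ (-s.re - θ)) := by
  refine norm_zetaTerm_le_of_forall fun x hx ↦ ?_
  have hn : (0 : ℝ) < n + 1 := by positivity
  have e1 := norm_cpow_neg_sub_cpow_neg_le hn hx hs
  have e2 := norm_cpow_neg_sub_cpow_neg_le_two hn hx hs
  set D := ‖((n + 1 + 1 : ℝ) : ℂ) ^ (-s) - (x : ℂ) ^ (-s)‖ with hD
  have hD0 : 0 ≤ D := norm_nonneg _
  calc D = D ^ θ * D ^ (1 - θ) := by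
        rw [← Real.rpow_add_of_nonneg hD0 h0 (by linarith)]; simp
    _ ≤ (‖s‖ * (n + 1 : ℝ) ^ (-s.re - 1)) ^ θ * (2 * (n + 1 : ℝ) ^ (-s.re)) ^ (1 - θ) := by
        gcongr
    _ = 2 ^ (1 - θ) * ‖s‖ ^ θ * (n + 1 : ℝ) ^ (-s.re - θ) := by
        rw [Real.mul_rpow (norm_nonneg _) (by positivity),
          Real.mul_rpow (by norm_num) (by positivity), ← Real.rpow_mul hn.le, ← Real.rpow_mul hn.le]
        have : (n + 1 : ℝ) ^ (-s.re - θ) =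
            (n + 1 : ℝ) ^ ((-s.re - 1) * θ) * (n + 1 : ℝ) ^ (-s.re * (1 - θ)) := by
          rw [← Real.rpow_add hn]; congr 1; ring
        rw [this]; ring
    _ ≤ _ := by
        gcongr
        calc (2 : ℝ) ^ (1 - θ) ≤ 2 ^ (1 : ℝ) := by
              apply Real.rpow_le_rpow_of_exponent_le <;> linarith
          _ = 2 := by simp

theorem summable_succ_rpow {r : ℝ} (hr : r < -1) : Summable fun n : ℕ ↦ (n + 1 : ℝ) ^ r := by
  have := (summable_nat_add_iff 1).2 (Real.summable_nat_rpow.2 hr)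
  simpa using this

theorem hasSum_zetaTerm_of_one_lt_re {s : ℂ} (hs : 1 < s.re) :
    HasSum (fun n ↦ zetaTerm n s) (riemannZeta₁ s - s) := by
  have hs1 : s ≠ 1 := by rintro rfl; simp at hs
  have hsum : Summable (fun n : ℕ ↦ zetaTerm n s) := by
    refine Summable.of_norm_bounded (g := fun n : ℕ ↦ ‖s - 1‖ * (‖s‖ * (n + 1 : ℝ) ^ (-s.re - 1)))
      (((summable_succ_rpow (by linarith)).mul_left _).mul_left _)
      (fun n ↦ norm_zetaTerm_le n (by linarith))
  have h1 : Tendsto (fun N : ℕ ↦ ∑ n ∈ Finset.range N, zetaTerm n s) atTop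
      (𝓝 ((s - 1) * (riemannZeta s - 1) + 0 - 1)) := by
    have e : ∀ N : ℕ, ∑ n ∈ Finset.range N, zetaTerm n s =
        (s - 1) * (∑ n ∈ Finset.range (N + 1), 1 / ((n + 1 : ℂ)) ^ s - 1) +
          ((N + 1 : ℕ) : ℂ) ^ (1 - s) - 1 := by
      intro N
      induction N with
      | zero => simp
      | succ N ih =>
        rw [Finset.sum_range_succ, ih, Finset.sum_range_succ (n := N + 1)]
        unfold zetaTerm
        push_cast
        rw [show (N : ℂ) + 1 + 1 = N + 2 by ring, Complex.cpow_neg, one_div]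
        ring
    simp_rw [e]
    refine Tendsto.sub (Tendsto.add ?_ ?_) tendsto_const_nhds
    · refine Tendsto.const_mul _ (Tendsto.sub ?_ tendsto_const_nhds)
      have hz : HasSum (fun n : ℕ ↦ 1 / ((n + 1 : ℂ)) ^ s) (riemannZeta s) := by
        rw [zeta_eq_tsum_one_div_nat_add_one_cpow hs]
        refine Summable.hasSum ?_
        have := (summable_nat_add_iff 1).2 (Complex.summable_one_div_nat_cpow.2 hs)
        simpa using this
      exact (tendsto_add_atTop_iff_nat 1).2 hz.tendsto_sum_nat
    · rw [tendsto_zero_iff_norm_tendsto_zero]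
      have : ∀ N : ℕ, ‖((N + 1 : ℕ) : ℂ) ^ (1 - s)‖ = ((N + 1 : ℕ) : ℝ) ^ (-(s.re - 1)) := by
        intro N
        rw [Complex.norm_natCast_cpow_of_pos (by omega)]
        simp
      simp_rw [this]
      exact (tendsto_rpow_neg_atTop (by linarith)).comp
        (tendsto_natCast_atTop_atTop.comp (tendsto_add_atTop_nat 1))
  have h2 : (s - 1) * (riemannZeta s - 1) + 0 - 1 = riemannZeta₁ s - s := by
    rw [riemannZeta_eq_inv_sub_mul hs1]
    have : s - 1 ≠ 0 := sub_ne_zero.2 hs1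
    field_simp
    ring
  rw [← h2]
  exact (hsum.hasSum_iff_tendsto_nat).2 h1

/-- Euler–Maclaurin formula for `(s - 1) ζ(s)`. -/
theorem riemannZeta₁_eq_add_tsum {s : ℂ} (hs : 1 / 2 < s.re) :
    riemannZeta₁ s = s + ∑' n, zetaTerm n s := by
  set R : ℝ := ‖s‖ + 3
  set V : Set ℂ := {z | 1 / 2 < z.re} ∩ Metric.ball 0 R with hV
  have hVo : IsOpen V := (isOpen_lt continuous_const Complex.continuous_re).inter Metric.isOpen_ball
  have hVc : Convex ℝ V := (convex_halfSpace_re_gt _).inter (convex_ball _ _)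
  have hd : DifferentiableOn ℂ (fun z ↦ z + ∑' n, zetaTerm n z) V := by
    refine differentiableOn_id.add ?_
    refine Complex.differentiableOn_tsum_of_summable_norm
      (u := fun n : ℕ ↦ (R + 1) * (R * (n + 1 : ℝ) ^ (-(1 / 2 : ℝ) - 1)))
      (((summable_succ_rpow (by norm_num)).mul_left _).mul_left _)
      (fun n ↦ (differentiable_zetaTerm n).differentiableOn) hVo ?_
    rintro n z ⟨hz1, hz2⟩
    have hz1' : 1 / 2 < z.re := hz1
    have hz2' : ‖z‖ < R := by simpa using hz2
    refine (norm_zetaTerm_le n (by linarith)).trans ?_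
    have : ‖z - 1‖ ≤ R + 1 := (norm_sub_le _ _).trans (by simp; linarith)
    gcongr
    · linarith
  have hmem : s ∈ V := ⟨hs, by simp [R]⟩
  have h2 : (2 : ℂ) ∈ V := ⟨by norm_num, by simp [R]; linarith [norm_nonneg s]⟩
  refine AnalyticOnNhd.eqOn_of_preconnected_of_eventuallyEq
    (differentiable_riemannZeta₁.differentiableOn.analyticOnNhd hVo)
    (hd.analyticOnNhd hVo) hVc.isPreconnected h2 ?_ hmem
  have : ∀ᶠ z : ℂ in 𝓝 2, 1 < z.re :=
    (isOpen_lt continuous_const Complex.continuous_re).mem_nhds (by norm_num)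
  filter_upwards [this] with z hz
  rw [(hasSum_zetaTerm_of_one_lt_re hz).tsum_eq]
  ring

theorem norm_riemannZeta₁_le {δ : ℝ} (hδ : 0 < δ) (hδ' : δ < 1 / 2) :
    ∃ C, 0 < C ∧ ∀ s : ℂ, 1 - δ ≤ s.re → ‖riemannZeta₁ s‖ ≤ C * ‖s‖ * (1 + ‖s‖) ^ (2 * δ) := by
  set S := ∑' n : ℕ, (n + 1 : ℝ) ^ (-1 - δ) with hS
  have hsm : Summable fun n : ℕ ↦ (n + 1 : ℝ) ^ (-1 - δ) := summable_succ_rpow (by linarith)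
  have hS0 : 0 ≤ S := tsum_nonneg fun n ↦ by positivity
  refine ⟨1 + 6 * S, by positivity, fun s hs ↦ ?_⟩
  have hs' : 1 / 2 < s.re := by linarith
  have hns : 1 / 2 ≤ ‖s‖ := hs'.le.trans (Complex.re_le_norm s)
  rw [riemannZeta₁_eq_add_tsum hs']
  have h1 : ‖∑' n, zetaTerm n s‖ ≤ (‖s - 1‖ * (2 * ‖s‖ ^ (2 * δ))) * S := by
    refine tsum_of_norm_bounded ((hsm.hasSum).mul_left _) fun n ↦ ?_
    refine (norm_zetaTerm_le_rpow n (by linarith) (θ := 2 * δ) (by linarith)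
      (by linarith)).trans ?_
    rw [← mul_assoc]
    have : (n + 1 : ℝ) ^ (-s.re - 2 * δ) ≤ (n + 1 : ℝ) ^ (-1 - δ) := by
      apply Real.rpow_le_rpow_of_exponent_le <;> linarith [(n.cast_nonneg : (0 : ℝ) ≤ n)]
    gcongr
  have h2 : ‖s - 1‖ ≤ 3 * ‖s‖ := by
    refine (norm_sub_le _ _).trans ?_
    simp; linarith
  have h3 : (1 : ℝ) ≤ (1 + ‖s‖) ^ (2 * δ) := Real.one_le_rpow (by linarith) (by linarith)
  have h4 : ‖s‖ ^ (2 * δ) ≤ (1 + ‖s‖) ^ (2 * δ) := by gcongr; linarith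
  calc ‖s + ∑' n, zetaTerm n s‖ ≤ ‖s‖ + ‖∑' n, zetaTerm n s‖ := norm_add_le _ _
    _ ≤ ‖s‖ * (1 + ‖s‖) ^ (2 * δ) + (3 * ‖s‖ * (2 * (1 + ‖s‖) ^ (2 * δ))) * S := by
        gcongr
        · exact le_mul_of_one_le_right (by positivity) h3
        · exact h1.trans (by gcongr)
    _ = _ := by ring

/-- The open strip `1 < Re s < 2`. -/
def rightStrip : Set ℂ := {s | 1 < s.re ∧ s.re < 2}

theorem isOpen_rightStrip : IsOpen rightStrip :=
  (isOpen_lt continuous_const Complex.continuous_re).inter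
    (isOpen_lt Complex.continuous_re continuous_const)

/-- `f` is holomorphic on the strip and its derivatives of order at most `n` are
`O((1 + ‖s‖) ^ (a + ε))` there for every `ε > 0`. -/
def SlowGrowth (a : ℝ) (n : ℕ) : (ℂ → ℂ) → Prop :=
  let base (f : ℂ → ℂ) : Prop := DifferentiableOn ℂ f rightStrip ∧
    ∀ ε : ℝ, ε > 0 → ∃ C : ℝ, ∀ s ∈ rightStrip, ‖f s‖ ≤ C * (1 + ‖s‖) ^ (a + ε)
  Nat.rec base (fun _ ih f ↦ base f ∧ ih (deriv f)) n

namespace SlowGrowth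

variable {a b : ℝ} {n : ℕ} {f g : ℂ → ℂ}

theorem zero (h : SlowGrowth a n f) : SlowGrowth a 0 f := by
  cases n with
  | zero => exact h
  | succ n => exact h.1

theorem pred (h : SlowGrowth a (n + 1) f) : SlowGrowth a n f := by
  induction n generalizing f with
  | zero => exact h.1
  | succ n ih => exact ⟨h.1, ih h.2⟩

theorem congr (h : SlowGrowth a n f) (hfg : Set.EqOn g f rightStrip) : SlowGrowth a n g := by
  induction n generalizing f g with
  | zero =>
    refine ⟨h.1.congr hfg, fun ε hε ↦ ?_⟩
    obtain ⟨C, hC⟩ := h.2 ε hε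
    exact ⟨C, fun s hs ↦ by rw [hfg hs]; exact hC s hs⟩
  | succ n ih =>
    refine ⟨?_, ih h.2 fun s hs ↦ ?_⟩
    · refine ⟨h.1.1.congr hfg, fun ε hε ↦ ?_⟩
      obtain ⟨C, hC⟩ := h.1.2 ε hε
      exact ⟨C, fun s hs ↦ by rw [hfg hs]; exact hC s hs⟩
    · exact (hfg.eventuallyEq_of_mem (isOpen_rightStrip.mem_nhds hs)).deriv_eq

theorem differentiableAt (h : SlowGrowth a n f) {s : ℂ} (hs : s ∈ rightStrip) :
    DifferentiableAt ℂ f s :=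
  h.zero.1.differentiableAt (isOpen_rightStrip.mem_nhds hs)

theorem mono (h : SlowGrowth a n f) (hab : a ≤ b) : SlowGrowth b n f := by
  induction n generalizing f with
  | zero =>
    refine ⟨h.1, fun ε hε ↦ ?_⟩
    obtain ⟨C, hC⟩ := h.2 ε hε
    refine ⟨|C|, fun s hs ↦ (hC s hs).trans ?_⟩
    have h1 : 1 ≤ 1 + ‖s‖ := by linarith [norm_nonneg s]
    gcongr
    exact le_abs_self C
  | succ n ih =>
    refine ⟨?_, ih h.2⟩
    refine ⟨h.1.1, fun ε hε ↦ ?_⟩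
    obtain ⟨C, hC⟩ := h.1.2 ε hε
    refine ⟨|C|, fun s hs ↦ (hC s hs).trans ?_⟩
    have h1 : 1 ≤ 1 + ‖s‖ := by linarith [norm_nonneg s]
    gcongr
    exact le_abs_self C

theorem neg (h : SlowGrowth a n f) : SlowGrowth a n (fun s ↦ -f s) := by
  induction n generalizing f with
  | zero => exact ⟨h.1.neg, by simpa using h.2⟩
  | succ n ih =>
    refine ⟨⟨h.1.1.neg, by simpa using h.1.2⟩, (ih h.2).congr fun s _ ↦ ?_⟩
    exact deriv.fun_neg

theorem add (hf : SlowGrowth a n f) (hg : SlowGrowth a n g) :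
    SlowGrowth a n (fun s ↦ f s + g s) := by
  have base : ∀ {f g : ℂ → ℂ}, SlowGrowth a 0 f → SlowGrowth a 0 g →
      SlowGrowth a 0 (fun s ↦ f s + g s) := by
    intro f g hf hg
    refine ⟨hf.1.add hg.1, fun ε hε ↦ ?_⟩
    obtain ⟨C, hC⟩ := hf.2 ε hε
    obtain ⟨D, hD⟩ := hg.2 ε hε
    refine ⟨C + D, fun s hs ↦ (norm_add_le _ _).trans ?_⟩
    rw [add_mul]
    exact add_le_add (hC s hs) (hD s hs)
  induction n generalizing f g with
  | zero => exact base hf hg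
  | succ n ih =>
    refine ⟨base hf.1 hg.1, (ih hf.2 hg.2).congr fun s hs ↦ ?_⟩
    exact deriv_fun_add (hf.differentiableAt hs) (hg.differentiableAt hs)

theorem mul (hf : SlowGrowth a n f) (hg : SlowGrowth b n g) :
    SlowGrowth (a + b) n (fun s ↦ f s * g s) := by
  have base : ∀ {f g : ℂ → ℂ}, SlowGrowth a 0 f → SlowGrowth b 0 g →
      SlowGrowth (a + b) 0 (fun s ↦ f s * g s) := by
    intro f g hf hg
    refine ⟨hf.1.mul hg.1, fun ε hε ↦ ?_⟩
    obtain ⟨C, hC⟩ := hf.2 (ε / 2) (by positivity)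
    obtain ⟨D, hD⟩ := hg.2 (ε / 2) (by positivity)
    refine ⟨C * D, fun s hs ↦ ?_⟩
    have h1 : 0 < 1 + ‖s‖ := by positivity
    calc ‖f s * g s‖ = ‖f s‖ * ‖g s‖ := norm_mul _ _
      _ ≤ (C * (1 + ‖s‖) ^ (a + ε / 2)) * (D * (1 + ‖s‖) ^ (b + ε / 2)) :=
          mul_le_mul (hC s hs) (hD s hs) (norm_nonneg _) ((norm_nonneg _).trans (hC s hs))
      _ = C * D * ((1 + ‖s‖) ^ (a + ε / 2) * (1 + ‖s‖) ^ (b + ε / 2)) := by ring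
      _ = _ := by rw [← Real.rpow_add h1]; congr 2; ring
  induction n generalizing f g with
  | zero => exact base hf hg
  | succ n ih =>
    refine ⟨base hf.1 hg.1, ((ih hf.2 hg.pred).add (ih hf.pred hg.2)).congr fun s hs ↦ ?_⟩
    exact deriv_fun_mul (hf.differentiableAt hs) (hg.differentiableAt hs)

theorem inv (hf : SlowGrowth 0 n f) (h0 : ∀ s ∈ rightStrip, f s ≠ 0)
    (hi : ∀ ε : ℝ, ε > 0 → ∃ C : ℝ, ∀ s ∈ rightStrip, ‖(f s)⁻¹‖ ≤ C * (1 + ‖s‖) ^ ε) :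
    SlowGrowth 0 n (fun s ↦ (f s)⁻¹) := by
  have base : SlowGrowth 0 0 (fun s ↦ (f s)⁻¹) :=
    ⟨hf.zero.1.inv h0, by simpa using hi⟩
  induction n with
  | zero => exact base
  | succ n ih =>
    have h1 := ih hf.pred
    have hd : SlowGrowth 0 n (deriv f) := hf.2
    have h2 := ((hd.mul h1).mul h1).neg
    norm_num only at h2
    refine ⟨base, h2.congr fun s hs ↦ ?_⟩
    rw [deriv_fun_inv'' (hf.differentiableAt hs) (h0 s hs)]
    field_simp

theorem iterate_deriv (hf : SlowGrowth a n f) : SlowGrowth a 0 (deriv^[n] f) := by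
  induction n generalizing f with
  | zero => exact hf
  | succ n ih => exact ih hf.2

end SlowGrowth

theorem slowGrowth_inv (n : ℕ) : SlowGrowth (-1) n (fun s ↦ s⁻¹) := by
  have h0 : ∀ s ∈ rightStrip, s ≠ 0 := by
    rintro s hs rfl
    have := hs.1
    simp at this
    linarith
  have base : SlowGrowth (-1) 0 (fun s ↦ s⁻¹) := by
    refine ⟨differentiableOn_id.inv h0, fun ε hε ↦ ⟨2, fun s hs ↦ ?_⟩⟩
    have h1 : 1 < ‖s‖ := hs.1.trans_le (Complex.re_le_norm s)
    rw [norm_inv]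
    calc ‖s‖⁻¹ ≤ 2 * (1 + ‖s‖) ^ (-1 : ℝ) := by
          rw [Real.rpow_neg_one, ← div_eq_mul_inv, inv_le_comm₀ (by linarith) (by positivity)]
          rw [inv_div]; linarith
      _ ≤ _ := by
          gcongr <;> linarith
  induction n with
  | zero => exact base
  | succ n ih =>
    refine ⟨base, ((ih.mul ih).neg.mono (by norm_num)).congr fun s hs ↦ ?_⟩
    simp only [deriv_inv]
    have := h0 s hs
    field_simp

/-- `f` is holomorphic on `Re s > 1/2` and for every `ε > 0` it is `O((1 + ‖s‖) ^ ε)` in some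
neighbourhood `Re s > 1 - δ` of the closed half-plane. -/
def SlowGrowthNearOne (f : ℂ → ℂ) : Prop :=
  DifferentiableOn ℂ f {s | 1 / 2 < s.re} ∧
    ∀ ε : ℝ, ε > 0 → ∃ δ : ℝ, 0 < δ ∧ δ < 1 / 2 ∧ ∃ C : ℝ, ∀ s : ℂ, 1 - δ < s.re → ‖f s‖ ≤ C * (1 + ‖s‖) ^ ε

theorem SlowGrowthNearOne.deriv {f : ℂ → ℂ} (hf : SlowGrowthNearOne f) :
    SlowGrowthNearOne (deriv f) := by
  have ho : IsOpen {s : ℂ | 1 / 2 < s.re} := isOpen_lt continuous_const Complex.continuous_re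
  refine ⟨hf.1.deriv ho, fun ε hε ↦ ?_⟩
  obtain ⟨δ, h0, h1, C, hC⟩ := hf.2 ε hε
  refine ⟨δ / 2, by positivity, by linarith, |C| * 2 ^ ε / (δ / 3), fun s hs ↦ ?_⟩
  have hsub : ∀ z ∈ Metric.closedBall s (δ / 3), 1 - δ < z.re := by
    intro z hz
    have : |(z - s).re| ≤ δ / 3 := (Complex.abs_re_le_norm _).trans (by
      rwa [Metric.mem_closedBall, dist_eq_norm] at hz)
    rw [Complex.sub_re, abs_le] at this
    linarith
  have := Complex.norm_deriv_le_of_forall_mem_sphere_norm_le (c := s) (R := δ / 3) (f := f)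
    (C := |C| * (2 ^ ε * (1 + ‖s‖) ^ ε)) (by positivity) ?_ ?_
  · refine this.trans (le_of_eq ?_)
    ring
  · refine DifferentiableOn.diffContOnCl ?_
    rw [closure_ball _ (by positivity)]
    refine hf.1.mono fun z hz ↦ ?_
    have := hsub z hz
    simp only [Set.mem_ofPred_eq]
    linarith
  · intro z hz
    refine (hC z (hsub z (Metric.sphere_subset_closedBall hz))).trans ?_
    have hz' : ‖z - s‖ = δ / 3 := by simpa [dist_eq_norm] using hz
    have h2 : ‖z‖ ≤ ‖s‖ + 1 := by
      have := norm_add_le s (z - s)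
      rw [add_sub_cancel] at this
      linarith
    rw [← Real.mul_rpow (by norm_num) (by positivity)]
    gcongr
    · exact le_abs_self C
    · linarith [norm_nonneg s]

theorem SlowGrowthNearOne.slowGrowth {f : ℂ → ℂ} (hf : SlowGrowthNearOne f) (n : ℕ) :
    SlowGrowth 0 n f := by
  have base : ∀ {f : ℂ → ℂ}, SlowGrowthNearOne f → SlowGrowth 0 0 f := by
    intro f hf
    refine ⟨hf.1.mono fun s hs ↦ ?_, fun ε hε ↦ ?_⟩
    · have := hs.1
      simp only [Set.mem_ofPred_eq]
      linarith
    · obtain ⟨δ, h0, h1, C, hC⟩ := hf.2 ε hε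
      exact ⟨C, fun s hs ↦ by rw [zero_add]; exact hC s (by linarith [hs.1])⟩
  induction n generalizing f with
  | zero => exact base hf
  | succ n ih => exact ⟨base hf, ih hf.deriv⟩

/-- The function `(s - 1) ζ(s) / s`. -/
def zetaQuot (s : ℂ) : ℂ := riemannZeta₁ s / s

theorem slowGrowthNearOne_zetaQuot : SlowGrowthNearOne zetaQuot := by
  constructor
  · refine differentiable_riemannZeta₁.differentiableOn.div differentiableOn_id ?_
    rintro s hs rfl
    simp at hs
    linarith
  · intro ε hε
    set δ := min (ε / 2) (1 / 4) with hδ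
    have hδ0 : 0 < δ := by positivity
    have hδ1 : δ ≤ 1 / 4 := min_le_right _ _
    have hδ2 : δ ≤ ε / 2 := min_le_left _ _
    obtain ⟨C, hC0, hC⟩ := norm_riemannZeta₁_le hδ0 (by linarith)
    refine ⟨δ, hδ0, by linarith, C, fun s hs ↦ ?_⟩
    have hs0 : 0 < ‖s‖ := by linarith [Complex.re_le_norm s]
    rw [zetaQuot, norm_div, div_le_iff₀ hs0]
    refine (hC s hs.le).trans ?_
    have : (1 + ‖s‖) ^ (2 * δ) ≤ (1 + ‖s‖) ^ ε := by
      apply Real.rpow_le_rpow_of_exponent_le <;> linarith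
    calc C * ‖s‖ * (1 + ‖s‖) ^ (2 * δ) ≤ C * ‖s‖ * (1 + ‖s‖) ^ ε := by gcongr
      _ = _ := by ring

theorem zetaQuot_eq {s : ℂ} (hs : s ≠ 1) : zetaQuot s = (s - 1) * riemannZeta s / s := by
  rw [zetaQuot, riemannZeta_eq_inv_sub_mul hs]
  have : s - 1 ≠ 0 := sub_ne_zero.2 hs
  field_simp

theorem zetaQuot_ne_zero {s : ℂ} (hs : 1 ≤ s.re) : zetaQuot s ≠ 0 := by
  have h0 : s ≠ 0 := by rintro rfl; simp at hs; linarith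
  by_cases h1 : s = 1
  · subst h1; simp [zetaQuot]
  · rw [zetaQuot_eq h1]
    exact div_ne_zero (mul_ne_zero (sub_ne_zero.2 h1) (riemannZeta_ne_zero_of_one_le_re hs)) h0

theorem norm_riemannZeta_product_ge_one {x : ℝ} (hx : 0 < x) (y : ℝ) :
    1 ≤ ‖riemannZeta (1 + x)‖ ^ 3 * ‖riemannZeta (1 + x + Complex.I * y)‖ ^ 4 *
      ‖riemannZeta (1 + x + 2 * Complex.I * y)‖ := by
  have := DirichletCharacter.norm_LFunction_product_ge_one (1 : DirichletCharacter ℂ 1) hx y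
  rw [DirichletCharacter.LFunctionTrivChar, DirichletCharacter.LFunction_modOne_eq,
    DirichletCharacter.LFunction_modOne_eq, norm_mul, norm_mul, norm_pow, norm_pow] at this
  exact this

theorem norm_zetaQuot_product_ge {x y : ℝ} (hx : 0 < x) (hx1 : x ≤ 1) (hy : 1 ≤ |y|) :
    x ^ 3 ≤ 2000 * (‖zetaQuot (1 + x)‖ ^ 3 * ‖zetaQuot (1 + x + Complex.I * y)‖ ^ 4 *
      ‖zetaQuot (1 + x + 2 * Complex.I * y)‖) := by
  have key : ∀ t : ℝ, 1 ≤ |t| → ‖riemannZeta (1 + x + Complex.I * t)‖ ≤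
      3 * ‖zetaQuot (1 + x + Complex.I * t)‖ := by
    intro t ht
    have hne : (1 + x + Complex.I * t : ℂ) ≠ 1 := by
      intro h
      have := congrArg Complex.re h
      simp at this
      linarith
    have h0 : |t| ≤ ‖(1 + x + Complex.I * t : ℂ) - 1‖ := by
      have := Complex.abs_im_le_norm ((1 + x + Complex.I * t : ℂ) - 1)
      simpa using this
    have h1 : ‖(1 + x + Complex.I * t : ℂ)‖ ≤ 3 * ‖(1 + x + Complex.I * t : ℂ) - 1‖ := by
      have : ‖(1 + x + Complex.I * t : ℂ)‖ ≤ ‖(1 + x + Complex.I * t : ℂ) - 1‖ + ‖(1 : ℂ)‖ := by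
        simpa using norm_add_le ((1 + x + Complex.I * t : ℂ) - 1) 1
      rw [norm_one] at this
      linarith
    have h2 : 0 < ‖(1 + x + Complex.I * t : ℂ)‖ := by
      rw [norm_pos_iff]
      intro h
      have := congrArg Complex.re h
      simp at this
      linarith
    rw [zetaQuot_eq hne, norm_div, norm_mul, ← mul_div_assoc, le_div_iff₀ h2]
    calc _ ≤ ‖riemannZeta (1 + x + Complex.I * t)‖ * (3 * ‖(1 + x + Complex.I * t : ℂ) - 1‖) := by
          gcongr
      _ = _ := by ring
  have hone : x * ‖riemannZeta (1 + x)‖ ≤ 2 * ‖zetaQuot (1 + x)‖ := by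
    have hne : (1 + x : ℂ) ≠ 1 := by
      intro h
      have := congrArg Complex.re h
      simp at this
      linarith
    have e : ‖(1 + x : ℂ)‖ = 1 + x := by
      rw [← Complex.ofReal_one, ← Complex.ofReal_add, Complex.norm_real, Real.norm_eq_abs,
        abs_of_pos (by linarith)]
    rw [zetaQuot_eq hne, norm_div, norm_mul, e, add_sub_cancel_left, Complex.norm_real,
      Real.norm_eq_abs, abs_of_pos hx, ← mul_div_assoc, le_div_iff₀ (by linarith)]
    have : 0 ≤ x * ‖riemannZeta (1 + x)‖ := by positivity
    nlinarith
  have k1 := key y hy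
  have k2 := key (2 * y) (by rw [abs_mul, abs_two]; linarith)
  push_cast at k2
  rw [← mul_assoc, mul_comm Complex.I 2] at k2
  have h := norm_riemannZeta_product_ge_one hx y
  calc x ^ 3 ≤ x ^ 3 * (‖riemannZeta (1 + x)‖ ^ 3 * ‖riemannZeta (1 + x + Complex.I * y)‖ ^ 4 *
      ‖riemannZeta (1 + x + 2 * Complex.I * y)‖) := le_mul_of_one_le_right (by positivity) h
    _ = (x * ‖riemannZeta (1 + x)‖) ^ 3 * ‖riemannZeta (1 + x + Complex.I * y)‖ ^ 4 *
      ‖riemannZeta (1 + x + 2 * Complex.I * y)‖ := by ring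
    _ ≤ (2 * ‖zetaQuot (1 + x)‖) ^ 3 * (3 * ‖zetaQuot (1 + x + Complex.I * y)‖) ^ 4 *
      (3 * ‖zetaQuot (1 + x + 2 * Complex.I * y)‖) := by gcongr
    _ ≤ _ := by
      rw [mul_pow, mul_pow]
      have : 0 ≤ ‖zetaQuot (1 + x)‖ ^ 3 * ‖zetaQuot (1 + x + Complex.I * y)‖ ^ 4 *
        ‖zetaQuot (1 + x + 2 * Complex.I * y)‖ := by positivity
      nlinarith

theorem norm_add_I_mul_le {x y c : ℝ} (hx : 0 < x) (hx1 : x ≤ 1) (hc : 0 ≤ c) (hc2 : c ≤ 2) :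
    1 + ‖(1 + x + c * Complex.I * y : ℂ)‖ ≤ 3 + 2 * |y| := by
  have h := norm_add₃_le (a := (1 : ℂ)) (b := (x : ℂ)) (c := c * Complex.I * y)
  simp only [norm_one, Complex.norm_real, norm_mul, Complex.norm_I, Real.norm_eq_abs, mul_one,
    abs_of_pos hx, abs_of_nonneg hc] at h
  have := mul_le_mul_of_nonneg_right hc2 (abs_nonneg y)
  linarith

theorem norm_inv_zetaQuot_le_of_one_le {ε : ℝ} (hε : 0 < ε) :
    ∃ C : ℝ, 0 ≤ C ∧ ∀ x y : ℝ, 0 < x → x ≤ 1 → 1 ≤ |y| →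
      ‖(zetaQuot (1 + x + Complex.I * y))⁻¹‖ ≤ C * (3 + 2 * |y|) ^ ε := by
  obtain ⟨δ₁, h10, -, C₁, hC₁⟩ := slowGrowthNearOne_zetaQuot.2 (ε / 7) (by positivity)
  obtain ⟨δ₂, h20, -, C₂, hC₂⟩ := slowGrowthNearOne_zetaQuot.deriv.2 (ε / 7) (by positivity)
  set C := max 1 (max C₁ C₂) with hC
  have hC1 : 1 ≤ C := le_max_left _ _
  have hCC1 : C₁ ≤ C := (le_max_left _ _).trans (le_max_right _ _)
  have hCC2 : C₂ ≤ C := (le_max_right _ _).trans (le_max_right _ _)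
  refine ⟨32000 * C ^ 7, by positivity, fun x y hx hx1 hy ↦ ?_⟩
  set T := 3 + 2 * |y| with hT
  have hT1 : 1 ≤ T := by rw [hT]; linarith
  set B := C * T ^ (ε / 7) with hB
  have hTp : 1 ≤ T ^ (ε / 7) := Real.one_le_rpow hT1 (by positivity)
  have hB1 : 1 ≤ B := one_le_mul_of_one_le_of_one_le hC1 hTp
  have bd : ∀ {u : ℝ}, 0 < u → u ≤ 1 → ∀ {c : ℝ}, 0 ≤ c → c ≤ 2 →
      ‖zetaQuot (1 + u + c * Complex.I * y)‖ ≤ B := by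
    intro u hu hu1 c hc hc2
    refine (hC₁ _ ?_).trans ?_
    · simp; linarith
    · have := norm_add_I_mul_le (y := y) hu hu1 hc hc2
      rw [hB]
      gcongr
  have bd' : ∀ {u : ℝ}, 0 < u → u ≤ 1 → ‖deriv zetaQuot (1 + u + Complex.I * y)‖ ≤ B := by
    intro u hu hu1
    refine (hC₂ _ ?_).trans ?_
    · simp; linarith
    · have := norm_add_I_mul_le (y := y) hu hu1 zero_le_one one_le_two
      rw [Complex.ofReal_one, one_mul] at this
      rw [hB]
      gcongr
  have low : ∀ {u : ℝ}, 0 < u → u ≤ 1 →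
      u ^ 3 ≤ 2000 * (B ^ 4 * ‖zetaQuot (1 + u + Complex.I * y)‖ ^ 4) := by
    intro u hu hu1
    refine (norm_zetaQuot_product_ge hu hu1 hy).trans ?_
    have e1 := bd hu hu1 le_rfl zero_le_two
    have e2 := bd hu hu1 zero_le_two le_rfl
    push_cast at e1 e2
    rw [zero_mul, zero_mul, add_zero] at e1
    calc _ ≤ 2000 * (B ^ 3 * ‖zetaQuot (1 + u + Complex.I * y)‖ ^ 4 * B) := by gcongr
      _ = _ := by ring
  set η := 1 / (32000 * B ^ 8) with hη
  have hη0 : 0 < η := by positivity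
  have hη1 : η ≤ 1 := by
    rw [hη, div_le_one (by positivity)]
    have : 1 ≤ B ^ 8 := one_le_pow₀ hB1
    linarith
  have main : η * B ≤ ‖zetaQuot (1 + x + Complex.I * y)‖ := by
    set u := max x η with hu
    have hu0 : 0 < u := lt_max_of_lt_left hx
    have hu1 : u ≤ 1 := max_le hx1 hη1
    have hux : u - x ≤ η := by
      rw [sub_le_iff_le_add]; exact max_le (by linarith) (by linarith)
    have hxu : x ≤ u := le_max_left _ _
    have h1 := low hu0 hu1
    have h2 : 2 * (η * B) ≤ ‖zetaQuot (1 + u + Complex.I * y)‖ := by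
      refine le_of_pow_le_pow_left₀ (n := 4) (by norm_num) (norm_nonneg _) ?_
      have h3 : η ^ 3 ≤ u ^ 3 := by gcongr; exact le_max_right _ _
      have h4 : η * (32000 * B ^ 8) = 1 := by rw [hη]; field_simp
      have h5 : 2000 * B ^ 4 * (2 * (η * B)) ^ 4 = η ^ 3 := by
        calc _ = η ^ 3 * (η * (32000 * B ^ 8)) := by ring
          _ = _ := by rw [h4, mul_one]
      have h6 : 2000 * B ^ 4 * (2 * (η * B)) ^ 4 ≤
          2000 * B ^ 4 * ‖zetaQuot (1 + u + Complex.I * y)‖ ^ 4 := by rw [h5]; linarith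
      exact le_of_mul_le_mul_left h6 (by positivity)
    have h3 : ‖zetaQuot (1 + u + Complex.I * y) - zetaQuot (1 + x + Complex.I * y)‖ ≤ B * η := by
      have := (convex_Icc x u).norm_image_sub_le_of_norm_hasDerivWithin_le
        (f := fun v : ℝ ↦ zetaQuot (1 + v + Complex.I * y))
        (f' := fun v : ℝ ↦ deriv zetaQuot (1 + v + Complex.I * y))
        (C := B) (x := x) (y := u) ?_ ?_ ⟨le_rfl, hxu⟩ ⟨hxu, le_rfl⟩
      · refine this.trans ?_
        rw [Real.norm_eq_abs, abs_of_nonneg (by linarith)]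
        gcongr
      · intro v hv
        have hd : HasDerivAt zetaQuot (deriv zetaQuot (1 + v + Complex.I * y))
            (1 + v + Complex.I * y) := by
          refine DifferentiableAt.hasDerivAt (slowGrowthNearOne_zetaQuot.1.differentiableAt
            ((isOpen_lt continuous_const Complex.continuous_re).mem_nhds ?_))
          simp
          linarith [hv.1]
        have hi : HasDerivAt (fun v : ℝ ↦ (1 + v + Complex.I * y : ℂ)) 1 v := by
          simpa using ((hasDerivAt_id v).ofReal_comp.const_add 1).add_const (Complex.I * y)
        have hc := hd.comp v hi
        rw [mul_one] at hc
        exact hc.hasDerivWithinAt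
      · intro v hv
        exact bd' (hx.trans_le hv.1) (hv.2.trans hu1)
    have h4 := norm_sub_norm_le (zetaQuot (1 + u + Complex.I * y))
      (zetaQuot (1 + x + Complex.I * y))
    linarith
  rw [norm_inv]
  have e : (η * B)⁻¹ = 32000 * C ^ 7 * T ^ ε := by
    have : T ^ ε = (T ^ (ε / 7)) ^ 7 := by
      rw [← Real.rpow_natCast, ← Real.rpow_mul (by linarith)]
      congr 1; push_cast; ring
    rw [this, hη, hB]
    field_simp
  rw [← e]
  exact inv_anti₀ (by positivity) main

theorem norm_inv_zetaQuot_le {ε : ℝ} (hε : 0 < ε) :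
    ∃ C : ℝ, ∀ s ∈ rightStrip, ‖(zetaQuot s)⁻¹‖ ≤ C * (1 + ‖s‖) ^ ε := by
  obtain ⟨C, hC0, hC⟩ := norm_inv_zetaQuot_le_of_one_le hε
  have hcomp : IsCompact (Set.Icc (1 : ℝ) 2 ×ℂ Set.Icc (-1 : ℝ) 1) :=
    isCompact_Icc.reProdIm isCompact_Icc
  have hcont : ContinuousOn (fun s ↦ (zetaQuot s)⁻¹) (Set.Icc (1 : ℝ) 2 ×ℂ Set.Icc (-1 : ℝ) 1) := by
    refine ContinuousOn.inv₀ (slowGrowthNearOne_zetaQuot.1.continuousOn.mono fun s hs ↦ ?_)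
      fun s hs ↦ zetaQuot_ne_zero ?_
    · have := (Complex.mem_reProdIm.1 hs).1.1
      simp only [Set.mem_ofPred_eq]
      linarith
    · exact (Complex.mem_reProdIm.1 hs).1.1
  obtain ⟨D, hD⟩ := hcomp.exists_bound_of_continuousOn hcont
  refine ⟨|D| + C * 3 ^ ε, fun s hs ↦ ?_⟩
  have h1 : 1 ≤ (1 + ‖s‖) ^ ε := Real.one_le_rpow (by linarith [norm_nonneg s]) hε.le
  have h3 : (0 : ℝ) ≤ 3 ^ ε := by positivity
  by_cases hy : 1 ≤ |s.im|
  · have := hC (s.re - 1) s.im (by linarith [hs.1]) (by linarith [hs.2]) hy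
    have e : (1 + (s.re - 1 : ℝ) + Complex.I * s.im : ℂ) = s := by
      apply Complex.ext <;> simp
    rw [e] at this
    have h2 : (3 + 2 * |s.im|) ^ ε ≤ 3 ^ ε * (1 + ‖s‖) ^ ε := by
      rw [← Real.mul_rpow (by norm_num) (by positivity)]
      gcongr
      linarith [Complex.abs_im_le_norm s, norm_nonneg s]
    calc _ ≤ C * (3 ^ ε * (1 + ‖s‖) ^ ε) := this.trans (by gcongr)
      _ = 0 + C * 3 ^ ε * (1 + ‖s‖) ^ ε := by ring
      _ ≤ |D| * (1 + ‖s‖) ^ ε + C * 3 ^ ε * (1 + ‖s‖) ^ ε := by gcongr; positivity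
      _ = _ := by ring
  · push Not at hy
    have := hD s (Complex.mem_reProdIm.2 ⟨⟨hs.1.le, hs.2.le⟩, abs_le.1 hy.le⟩)
    calc _ ≤ |D| := this.trans (le_abs_self D)
      _ ≤ |D| + C * 3 ^ ε := by linarith [mul_nonneg hC0 h3]
      _ ≤ _ := le_mul_of_one_le_right (by positivity) h1

/-- The Laplace transform `-(log ζ)′(s) / s - 1 / (s - 1)` of `ψ(e^u) - e^u`. -/
def psiTransform (s : ℂ) : ℂ := -s⁻¹ * (1 + deriv zetaQuot s * (zetaQuot s)⁻¹ + s⁻¹)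

theorem slowGrowth_const (n : ℕ) (c : ℂ) : SlowGrowth 0 n (fun _ ↦ c) := by
  refine SlowGrowthNearOne.slowGrowth ⟨differentiableOn_const c, fun ε hε ↦
    ⟨1 / 4, by norm_num, by norm_num, ‖c‖, fun s _ ↦ ?_⟩⟩ n
  exact le_mul_of_one_le_right (norm_nonneg _)
    (Real.one_le_rpow (by linarith [norm_nonneg s]) hε.le)

theorem slowGrowth_psiTransform (n : ℕ) : SlowGrowth (-1) n psiTransform := by
  have h1 := (slowGrowthNearOne_zetaQuot.slowGrowth n).inv
    (fun s hs ↦ zetaQuot_ne_zero hs.1.le) fun ε hε ↦ norm_inv_zetaQuot_le hε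
  have h2 := (slowGrowthNearOne_zetaQuot.deriv.slowGrowth n).mul h1
  rw [add_zero] at h2
  have h3 := ((slowGrowth_const n 1).add h2).add ((slowGrowth_inv n).mono (by norm_num))
  have h4 := (slowGrowth_inv n).neg.mul h3
  rw [add_zero] at h4
  exact h4.congr fun s _ ↦ rfl

theorem psiTransform_eq {s : ℂ} (hs : 1 < s.re) :
    psiTransform s = -(deriv riemannZeta s / riemannZeta s) / s - 1 / (s - 1) := by
  have hs1 : s ≠ 1 := by rintro rfl; simp at hs
  have hs0 : s ≠ 0 := by rintro rfl; simp at hs; linarith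
  have hz := riemannZeta_ne_zero_of_one_le_re hs.le
  have hs2 : s - 1 ≠ 0 := sub_ne_zero.2 hs1
  have hd : deriv zetaQuot s =
      (riemannZeta s + (s - 1) * deriv riemannZeta s) / s - (s - 1) * riemannZeta s / s ^ 2 := by
    have e : zetaQuot =ᶠ[𝓝 s] fun s ↦ (s - 1) * riemannZeta s / s := by
      filter_upwards [isOpen_ne.mem_nhds hs1] with z hz
      exact zetaQuot_eq hz
    rw [e.deriv_eq]
    have h := (((hasDerivAt_id s).sub_const 1).mul
      (differentiableAt_riemannZeta hs1).hasDerivAt).div (hasDerivAt_id s) hs0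
    refine h.deriv.trans ?_
    simp only [id, Pi.mul_apply]
    field_simp
  rw [psiTransform, hd, zetaQuot_eq hs1]
  field_simp
  ring

theorem integrableOn_pow_mul_exp_neg (k : ℕ) {b : ℝ} (hb : 0 < b) :
    MeasureTheory.IntegrableOn (fun u : ℝ ↦ u ^ k * Real.exp (-b * u)) (Set.Ioi 0) := by
  have := integrableOn_rpow_mul_exp_neg_mul_rpow (p := 1) (s := k) (b := b)
    (by have : (0 : ℝ) ≤ k := k.cast_nonneg
        linarith) one_pos hb
  simpa using this

/-- The function `ψ(e^u) - e^u` on the half-line `u > 0`. -/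
def psiErr : ℝ → ℝ := Set.indicator (Set.Ioi 0) fun u ↦ Chebyshev.psi (Real.exp u) - Real.exp u

theorem measurable_psiErr : Measurable psiErr :=
  ((Chebyshev.psi_mono.measurable.comp Real.measurable_exp).sub Real.measurable_exp).indicator
    measurableSet_Ioi

theorem abs_psiErr_le (u : ℝ) : |psiErr u| ≤ 7 * Real.exp u := by
  by_cases hu : u ∈ Set.Ioi (0 : ℝ)
  · rw [psiErr, Set.indicator_of_mem hu]
    have h1 := Chebyshev.psi_le_const_mul_self (Real.exp_pos u).le
    have h2 := Chebyshev.psi_nonneg (Real.exp u)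
    have h3 : Real.log 4 ≤ 2 := by
      have := Real.log_two_lt_d9
      rw [show (4 : ℝ) = 2 ^ 2 by norm_num, Real.log_pow]
      push_cast
      linarith
    have h4 : (Real.log 4 + 4) * Real.exp u ≤ 6 * Real.exp u := by gcongr; linarith
    rw [abs_le]
    constructor <;> linarith [Real.exp_pos u]
  · rw [psiErr, Set.indicator_of_notMem hu, abs_zero]
    positivity

/-- The function `u ^ k (ψ(e^u) - e^u) e^{-σu}` on the half-line `u > 0`. -/
def psiErrWeighted (σ : ℝ) (k : ℕ) (u : ℝ) : ℝ := u ^ k * (psiErr u * Real.exp (-σ * u))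

theorem measurable_psiErrWeighted (σ : ℝ) (k : ℕ) : Measurable (psiErrWeighted σ k) :=
  (measurable_id.pow_const k).mul (measurable_psiErr.mul (by fun_prop))

theorem psiErrWeighted_of_nonpos {σ : ℝ} {k : ℕ} {u : ℝ} (hu : u ≤ 0) :
    psiErrWeighted σ k u = 0 := by
  rw [psiErrWeighted, psiErr, Set.indicator_of_notMem (by simpa using hu)]
  simp

theorem abs_psiErrWeighted_le (σ : ℝ) (k : ℕ) (u : ℝ) : |psiErrWeighted σ k u| ≤
    Set.indicator (Set.Ioi 0) (fun u ↦ 7 * (u ^ k * Real.exp (-(σ - 1) * u))) u := by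
  by_cases hu : u ∈ Set.Ioi (0 : ℝ)
  · rw [Set.indicator_of_mem hu, psiErrWeighted, abs_mul, abs_mul, Real.abs_exp,
      abs_of_nonneg (pow_nonneg (le_of_lt hu) k)]
    calc _ ≤ u ^ k * (7 * Real.exp u * Real.exp (-σ * u)) := by
          have : (0 : ℝ) ≤ u ^ k := pow_nonneg (le_of_lt hu) k
          gcongr
          exact abs_psiErr_le u
      _ = _ := by
          rw [mul_assoc 7, ← Real.exp_add, show u + -σ * u = -(σ - 1) * u by ring]
          ring
  · rw [Set.indicator_of_notMem hu, psiErrWeighted_of_nonpos (by simpa using hu), abs_zero]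

theorem integrable_psiErrWeighted {σ : ℝ} (hσ : 1 < σ) (k : ℕ) :
    MeasureTheory.Integrable (psiErrWeighted σ k) := by
  refine MeasureTheory.Integrable.mono' (g := Set.indicator (Set.Ioi 0)
    (fun u ↦ 7 * (u ^ k * Real.exp (-(σ - 1) * u)))) ?_
    (measurable_psiErrWeighted σ k).aestronglyMeasurable
    (Eventually.of_forall fun u ↦ abs_psiErrWeighted_le σ k u)
  exact (MeasureTheory.integrable_indicator_iff measurableSet_Ioi).2
    ((integrableOn_pow_mul_exp_neg k (by linarith)).const_mul 7)

theorem integrable_psiErrWeighted_sq {σ : ℝ} (hσ : 1 < σ) (k : ℕ) :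
    MeasureTheory.Integrable (fun u ↦ psiErrWeighted σ k u ^ 2) := by
  refine MeasureTheory.Integrable.mono' (g := Set.indicator (Set.Ioi 0)
    (fun u ↦ 49 * (u ^ (2 * k) * Real.exp (-(2 * (σ - 1)) * u)))) ?_
    ((measurable_psiErrWeighted σ k).pow_const 2).aestronglyMeasurable
    (Eventually.of_forall fun u ↦ ?_)
  · exact (MeasureTheory.integrable_indicator_iff measurableSet_Ioi).2
      ((integrableOn_pow_mul_exp_neg (2 * k) (by linarith)).const_mul 49)
  · have := abs_psiErrWeighted_le σ k u
    rw [Real.norm_eq_abs, abs_pow]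
    refine (pow_le_pow_left₀ (abs_nonneg _) this 2).trans (le_of_eq ?_)
    by_cases hu : u ∈ Set.Ioi (0 : ℝ)
    · rw [Set.indicator_of_mem hu, Set.indicator_of_mem hu, mul_pow, mul_pow, ← pow_mul,
        ← Real.exp_nat_mul, mul_comm k 2]
      push_cast
      rw [show (2 : ℝ) * (-(σ - 1) * u) = -(2 * (σ - 1)) * u by ring]
      norm_num
    · rw [Set.indicator_of_notMem hu, Set.indicator_of_notMem hu]; norm_num

theorem memLp_psiErrWeighted {σ : ℝ} (hσ : 1 < σ) (k : ℕ) :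
    MeasureTheory.MemLp (psiErrWeighted σ k) 2 := by
  rw [MeasureTheory.memLp_two_iff_integrable_sq
    (measurable_psiErrWeighted σ k).aestronglyMeasurable]
  exact integrable_psiErrWeighted_sq hσ k

theorem laplace_psi {s : ℂ} (hs : 1 < s.re) :
    ∫ u in Set.Ioi (0 : ℝ), (Chebyshev.psi (Real.exp u) : ℂ) * Complex.exp (-s * u) =
      -(deriv riemannZeta s / riemannZeta s) / s := by
  have hs0 : s ≠ 0 := by rintro rfl; simp at hs; linarith
  have hpsi : ∀ t : ℝ, (∑ k ∈ Finset.Icc 1 ⌊t⌋₊, (ArithmeticFunction.vonMangoldt k : ℂ)) =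
      (Chebyshev.psi t : ℂ) := by
    intro t
    rw [Chebyshev.psi]
    push_cast
    rfl
  have h := LSeries_eq_mul_integral' (fun n ↦ (ArithmeticFunction.vonMangoldt n : ℂ))
    zero_le_one hs (by
      refine Asymptotics.IsBigO.of_bound (Real.log 4 + 4) (Eventually.of_forall fun n ↦ ?_)
      have := Chebyshev.psi_le_const_mul_self (x := n) n.cast_nonneg
      have h0 := Chebyshev.psi_nonneg n
      rw [Chebyshev.psi, Nat.floor_natCast] at this h0
      simp only [Complex.norm_real, Real.norm_eq_abs, Real.rpow_one, Nat.abs_cast]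
      have e : ∀ k ∈ Finset.Icc 1 n, |ArithmeticFunction.vonMangoldt k| =
          ArithmeticFunction.vonMangoldt k :=
        fun k _ ↦ abs_of_nonneg ArithmeticFunction.vonMangoldt_nonneg
      rw [Finset.sum_congr rfl e]
      change |∑ k ∈ Finset.Ioc 0 n, ArithmeticFunction.vonMangoldt k| ≤ _
      rwa [abs_of_nonneg h0])
  rw [ArithmeticFunction.LSeries_vonMangoldt_eq_deriv_riemannZeta_div hs] at h
  simp_rw [hpsi] at h
  have e1 := MeasureTheory.integral_image_eq_integral_abs_deriv_smul (s := Set.Ioi (0 : ℝ))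
    (f := Real.exp) (f' := Real.exp) measurableSet_Ioi
    (fun x _ ↦ (Real.hasDerivAt_exp x).hasDerivWithinAt) Real.exp_injective.injOn
    (fun t ↦ (Chebyshev.psi t : ℂ) * (t : ℂ) ^ (-(s + 1)))
  rw [Real.image_exp_Ioi, Real.exp_zero] at e1
  rw [e1] at h
  rw [eq_div_iff hs0, ← neg_div, h, mul_comm]
  congr 1
  refine MeasureTheory.setIntegral_congr_fun measurableSet_Ioi fun u _ ↦ ?_
  simp only [Real.abs_exp, Complex.real_smul]
  rw [Complex.cpow_def_of_ne_zero (by exact_mod_cast (Real.exp_pos u).ne'),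
    ← Complex.ofReal_log (Real.exp_pos u).le, Real.log_exp, Complex.ofReal_exp, mul_left_comm,
    ← Complex.exp_add]
  congr 2
  ring

theorem integrableOn_psi_mul_cexp {s : ℂ} (hs : 1 < s.re) :
    MeasureTheory.IntegrableOn
      (fun u : ℝ ↦ (Chebyshev.psi (Real.exp u) : ℂ) * Complex.exp (-s * u)) (Set.Ioi 0) := by
  refine MeasureTheory.Integrable.mono' (g := fun u ↦ 6 * (u ^ 0 * Real.exp (-(s.re - 1) * u)))
    ((integrableOn_pow_mul_exp_neg 0 (by linarith)).const_mul 6) ?_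
    (Eventually.of_forall fun u ↦ ?_)
  · exact ((Complex.measurable_ofReal.comp (Chebyshev.psi_mono.measurable.comp
      Real.measurable_exp)).mul (by fun_prop)).aestronglyMeasurable
  · have h1 := Chebyshev.psi_le_const_mul_self (Real.exp_pos u).le
    have h3 : Real.log 4 ≤ 2 := by
      have := Real.log_two_lt_d9
      rw [show (4 : ℝ) = 2 ^ 2 by norm_num, Real.log_pow]
      push_cast
      linarith
    have h4 : (Real.log 4 + 4) * Real.exp u ≤ 6 * Real.exp u := by gcongr; linarith
    rw [norm_mul, Complex.norm_real, Complex.norm_exp, Real.norm_eq_abs,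
      abs_of_nonneg (Chebyshev.psi_nonneg _)]
    calc _ ≤ 6 * Real.exp u * Real.exp (-s * u).re := by gcongr; linarith
      _ = _ := by
        rw [mul_assoc, ← Real.exp_add, pow_zero, one_mul]
        congr 2
        simp
        ring

theorem laplace_psiErr {s : ℂ} (hs : 1 < s.re) :
    ∫ u : ℝ, (psiErr u : ℂ) * Complex.exp (-s * u) = psiTransform s := by
  have hs1 : s - 1 ≠ 0 := by
    intro h
    rw [sub_eq_zero.1 h] at hs
    simp at hs
  have hre : (1 - s).re < 0 := by simp; linarith
  have e : ∀ u : ℝ, (psiErr u : ℂ) * Complex.exp (-s * u) = Set.indicator (Set.Ioi 0)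
      (fun u : ℝ ↦ (Chebyshev.psi (Real.exp u) : ℂ) * Complex.exp (-s * u) -
        Complex.exp ((1 - s) * u)) u := by
    intro u
    by_cases hu : u ∈ Set.Ioi (0 : ℝ)
    · rw [psiErr, Set.indicator_of_mem hu, Set.indicator_of_mem hu]
      push_cast
      rw [sub_mul, ← Complex.exp_add]
      congr 2
      ring
    · rw [psiErr, Set.indicator_of_notMem hu, Set.indicator_of_notMem hu]
      simp
  simp_rw [e]
  rw [MeasureTheory.integral_indicator measurableSet_Ioi,
    MeasureTheory.integral_sub (integrableOn_psi_mul_cexp hs)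
      (integrableOn_exp_mul_complex_Ioi hre 0), laplace_psi hs,
    integral_exp_mul_complex_Ioi hre 0, psiTransform_eq hs]
  have : (1 - s : ℂ) ≠ 0 := by rw [← neg_sub]; exact neg_ne_zero.2 hs1
  simp
  rw [← neg_sub s 1, div_neg, neg_div, neg_neg, one_div]

open FourierTransform

theorem fourier_psiErrWeighted {σ : ℝ} (hσ : 1 < σ) (ξ : ℝ) :
    𝓕 (fun u ↦ (psiErrWeighted σ 0 u : ℂ)) ξ = psiTransform (σ + 2 * π * Complex.I * ξ) := by
  rw [Real.fourier_real_eq_integral_exp_smul, ← laplace_psiErr (by simpa using hσ)]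
  congr 1
  ext u
  rw [psiErrWeighted, pow_zero, one_mul, smul_eq_mul]
  push_cast
  rw [mul_left_comm, ← Complex.exp_add]
  congr 2
  ring

theorem iteratedDeriv_psiTransform_line {σ : ℝ} (hσ : 1 < σ) (hσ2 : σ < 2) (k : ℕ) :
    iteratedDeriv k (fun ξ : ℝ ↦ psiTransform (σ + 2 * π * Complex.I * ξ)) =
      fun ξ : ℝ ↦ (2 * π * Complex.I) ^ k * deriv^[k] psiTransform (σ + 2 * π * Complex.I * ξ) := by
  induction k with
  | zero => ext; simp
  | succ k ih =>
    rw [iteratedDeriv_succ, ih]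
    ext ξ
    have hmem : (σ + 2 * π * Complex.I * ξ : ℂ) ∈ rightStrip := by
      simp [rightStrip, hσ, hσ2]
    have hd : HasDerivAt (deriv^[k] psiTransform)
        (deriv^[k + 1] psiTransform (σ + 2 * π * Complex.I * ξ)) (σ + 2 * π * Complex.I * ξ) := by
      rw [Function.iterate_succ_apply']
      exact ((slowGrowth_psiTransform k).iterate_deriv.differentiableAt hmem).hasDerivAt
    have hi : HasDerivAt (fun ξ : ℝ ↦ (σ + 2 * π * Complex.I * ξ : ℂ)) (2 * π * Complex.I) ξ := by
      simpa using ((hasDerivAt_id ξ).ofReal_comp.const_mul (2 * π * Complex.I)).const_add (σ : ℂ)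
    have := (hd.comp ξ hi).const_mul ((2 * π * Complex.I) ^ k)
    refine this.deriv.trans ?_
    ring

theorem norm_fourier_psiErrWeighted_le (k : ℕ) : ∃ C : ℝ, ∀ σ : ℝ, 1 < σ → σ < 2 → ∀ ξ : ℝ,
    ‖𝓕 (fun u ↦ (psiErrWeighted σ k u : ℂ)) ξ‖ ≤ C * (1 + ‖ξ‖) ^ (-(3 / 4) : ℝ) := by
  obtain ⟨C, hC⟩ := (slowGrowth_psiTransform k).iterate_deriv.2 (1 / 4) (by norm_num)
  refine ⟨|C|, fun σ hσ hσ2 ξ ↦ ?_⟩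
  have hint : ∀ n : ℕ, (n : ℕ∞) ≤ ⊤ → MeasureTheory.Integrable
      (fun u : ℝ ↦ u ^ n • (psiErrWeighted σ 0 u : ℂ)) := by
    intro n _
    refine ((integrable_psiErrWeighted hσ n).ofReal (𝕜 := ℂ)).congr
      (Eventually.of_forall fun u ↦ ?_)
    simp only [psiErrWeighted, pow_zero, one_mul, Complex.real_smul]
    push_cast
    simp
  have h1 := congrFun (Real.iteratedDeriv_fourier hint (n := k) le_top) ξ
  rw [funext (fourier_psiErrWeighted hσ), iteratedDeriv_psiTransform_line hσ hσ2] at h1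
  have e : (fun u : ℝ ↦ (-2 * π * Complex.I * u) ^ k • (psiErrWeighted σ 0 u : ℂ)) =
      fun u ↦ (-2 * π * Complex.I) ^ k • (psiErrWeighted σ k u : ℂ) := by
    ext u
    simp only [psiErrWeighted, pow_zero, one_mul, smul_eq_mul]
    push_cast
    rw [mul_pow]
    ring
  rw [e] at h1
  have e2 : 𝓕 (fun u : ℝ ↦ (-2 * π * Complex.I) ^ k • (psiErrWeighted σ k u : ℂ)) ξ =
      (-2 * π * Complex.I) ^ k • 𝓕 (fun u : ℝ ↦ (psiErrWeighted σ k u : ℂ)) ξ := by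
    simp only [Real.fourier_real_eq_integral_exp_smul, ← MeasureTheory.integral_smul]
    congr 1
    ext u
    simp only [smul_eq_mul]
    ring
  rw [e2] at h1
  have h2 := congrArg norm h1
  have e3 : ‖(-2 * π * Complex.I : ℂ)‖ = ‖(2 * π * Complex.I : ℂ)‖ := by
    rw [← norm_neg]; congr 1; ring
  have e4 : 0 < ‖(2 * π * Complex.I : ℂ)‖ := by
    rw [norm_pos_iff]
    simp [Real.pi_ne_zero]
  rw [norm_mul, norm_smul, norm_pow, norm_pow, e3] at h2
  have h3 := mul_left_cancel₀ (pow_pos e4 k).ne' h2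
  rw [← h3]
  have hmem : (σ + 2 * π * Complex.I * ξ : ℂ) ∈ rightStrip := by
    simp [rightStrip, hσ, hσ2]
  refine (hC _ hmem).trans ?_
  have h4 : ‖ξ‖ ≤ ‖(σ + 2 * π * Complex.I * ξ : ℂ)‖ := by
    have := Complex.abs_im_le_norm (σ + 2 * π * Complex.I * ξ : ℂ)
    simp only [Complex.add_im, Complex.ofReal_im, Complex.mul_im, Complex.mul_re] at this
    simp [abs_mul, abs_of_pos Real.pi_pos] at this
    rw [Real.norm_eq_abs]
    nlinarith [Real.pi_gt_three, abs_nonneg ξ]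
  rw [show (-1 + 1 / 4 : ℝ) = -(3 / 4) by norm_num]
  calc _ ≤ |C| * (1 + ‖(σ + 2 * π * Complex.I * ξ : ℂ)‖) ^ (-(3 / 4) : ℝ) := by
        gcongr
        exact le_abs_self C
    _ ≤ _ := by
        refine mul_le_mul_of_nonneg_left ?_ (abs_nonneg C)
        exact Real.rpow_le_rpow_of_nonpos (by positivity) (by linarith) (by norm_num)

open MeasureTheory in
theorem memLp_psiErrWeighted_one (k : ℕ) : MemLp (fun u ↦ (psiErrWeighted 1 k u : ℂ)) 2 := by
  obtain ⟨C, hC⟩ := norm_fourier_psiErrWeighted_le k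
  have hmaj : MemLp (fun ξ : ℝ ↦ C * (1 + ‖ξ‖) ^ (-(3 / 4) : ℝ)) 2 := by
    refine MemLp.const_mul ?_ C
    have hm : Measurable fun ξ : ℝ ↦ (1 + ‖ξ‖) ^ (-(3 / 4) : ℝ) := by fun_prop
    rw [memLp_two_iff_integrable_sq hm.aestronglyMeasurable]
    have := integrable_one_add_norm (E := ℝ) (μ := volume) (r := 3 / 2) (by norm_num)
    refine this.congr (Eventually.of_forall fun ξ ↦ ?_)
    simp only
    rw [← Real.rpow_natCast, ← Real.rpow_mul (by positivity)]
    norm_num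
  have bound : ∀ σ : ℝ, 1 < σ → σ < 2 → eLpNorm (fun u ↦ (psiErrWeighted σ k u : ℂ)) 2 ≤
      eLpNorm (fun ξ : ℝ ↦ C * (1 + ‖ξ‖) ^ (-(3 / 4) : ℝ)) 2 := by
    intro σ hσ hσ2
    have hi : Integrable fun u ↦ (psiErrWeighted σ k u : ℂ) :=
      (integrable_psiErrWeighted hσ k).ofReal
    have hcont : Continuous (𝓕 fun u ↦ (psiErrWeighted σ k u : ℂ)) :=
      VectorFourier.fourierIntegral_continuous Real.continuous_fourierChar continuous_inner hi
    refine (eLpNorm_two_le_eLpNorm_fourier hi (memLp_psiErrWeighted hσ k).ofReal ?_).trans ?_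
    · exact hmaj.mono' hcont.aestronglyMeasurable (Eventually.of_forall (hC σ hσ hσ2))
    · exact eLpNorm_mono_real (hC σ hσ hσ2)
  have hmeas : ∀ σ, AEStronglyMeasurable (fun u ↦ (psiErrWeighted σ k u : ℂ)) := fun σ ↦
    (Complex.measurable_ofReal.comp (measurable_psiErrWeighted σ k)).aestronglyMeasurable
  refine ⟨hmeas 1, lt_of_le_of_lt ?_ hmaj.2⟩
  refine (Lp.eLpNorm_lim_le_liminf_eLpNorm
    (f := fun (n : ℕ) u ↦ (psiErrWeighted (1 + 1 / ((n : ℝ) + 1 + 1)) k u : ℂ))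
    (fun n ↦ hmeas _) _ (Eventually.of_forall fun u ↦ ?_)).trans ?_
  · have h1 : Tendsto (fun n : ℕ ↦ 1 + 1 / ((n : ℝ) + 1 + 1)) atTop (𝓝 (1 + 0)) := by
      refine Tendsto.const_add 1 ?_
      have := (tendsto_add_atTop_iff_nat 1).2 (tendsto_one_div_add_atTop_nhds_zero_nat (𝕜 := ℝ))
      simpa using this
    rw [add_zero] at h1
    have h2 : Continuous fun σ : ℝ ↦ (psiErrWeighted σ k u : ℂ) := by
      unfold psiErrWeighted
      fun_prop
    exact (h2.tendsto 1).comp h1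
  · refine Filter.liminf_le_of_le (by isBoundedDefault) fun b hb ↦ ?_
    obtain ⟨n, hn⟩ := hb.exists
    refine hn.trans (bound _ ?_ ?_)
    · have : (0 : ℝ) < 1 / ((n : ℝ) + 1 + 1) := by positivity
      linarith
    · have : 1 / ((n : ℝ) + 1 + 1) < 1 := by
        rw [div_lt_one (by positivity)]
        have : (0 : ℝ) ≤ n := n.cast_nonneg
        linarith
      linarith

open MeasureTheory in
theorem integrable_psiErrWeighted_one (k : ℕ) : Integrable (psiErrWeighted 1 k) := by
  have h1 : MemLp (fun u ↦ psiErrWeighted 1 k u + psiErrWeighted 1 (k + 1) u) 2 := by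
    have a := (memLp_psiErrWeighted_one k).re
    have b := (memLp_psiErrWeighted_one (k + 1)).re
    exact a.add b
  have h2 : MemLp (fun u : ℝ ↦ (1 + ‖u‖)⁻¹) 2 := by
    have hm : Measurable fun ξ : ℝ ↦ (1 + ‖ξ‖)⁻¹ := by fun_prop
    rw [memLp_two_iff_integrable_sq hm.aestronglyMeasurable]
    have := integrable_one_add_norm (E := ℝ) (μ := volume) (r := 2) (by norm_num)
    refine this.congr (Eventually.of_forall fun ξ ↦ ?_)
    simp only
    rw [Real.rpow_neg (by positivity), inv_pow]
    norm_cast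
  refine (h1.integrable_mul h2).congr (Eventually.of_forall fun u ↦ ?_)
  simp only [Pi.mul_apply]
  by_cases hu : 0 < u
  · rw [Real.norm_eq_abs, abs_of_pos hu, ← div_eq_mul_inv, div_eq_iff (by linarith)]
    simp only [psiErrWeighted]
    ring
  · rw [psiErrWeighted_of_nonpos (not_lt.1 hu), psiErrWeighted_of_nonpos (not_lt.1 hu)]
    simp

open MeasureTheory in
/-- The prime number theorem with an error term smaller, on average, than every power of the
logarithm. -/
theorem integrableOn_theta_sub_self (k : ℕ) :
    IntegrableOn (fun x ↦ Real.log x ^ k * (Chebyshev.theta x - x) / x ^ 2) (Set.Ioi 1) := by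
  have e := integrableOn_image_iff_integrableOn_abs_deriv_smul (s := Set.Ioi (0 : ℝ))
    (f := Real.exp) (f' := Real.exp) measurableSet_Ioi
    (fun x _ ↦ (Real.hasDerivAt_exp x).hasDerivWithinAt) Real.exp_injective.injOn
    (fun x ↦ Real.log x ^ k * (Chebyshev.theta x - x) / x ^ 2)
  rw [Real.image_exp_Ioi, Real.exp_zero] at e
  rw [e]
  have h1 : IntegrableOn (psiErrWeighted 1 k) (Set.Ioi 0) :=
    (integrable_psiErrWeighted_one k).integrableOn
  have hm : Measurable fun u : ℝ ↦
      u ^ k * (Chebyshev.psi (Real.exp u) - Chebyshev.theta (Real.exp u)) * Real.exp (-u) :=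
    ((measurable_id.pow_const k).mul
      ((Chebyshev.psi_mono.measurable.comp Real.measurable_exp).sub
        (Chebyshev.theta_mono.measurable.comp Real.measurable_exp))).mul (by fun_prop)
  have h2 : IntegrableOn (fun u : ℝ ↦
      u ^ k * (Chebyshev.psi (Real.exp u) - Chebyshev.theta (Real.exp u)) * Real.exp (-u))
      (Set.Ioi 0) := by
    refine Integrable.mono' ((integrableOn_pow_mul_exp_neg (k + 1)
      (b := 1 / 2) (by norm_num)).const_mul 2) hm.aestronglyMeasurable ?_
    refine (ae_restrict_iff' measurableSet_Ioi).2 (Eventually.of_forall fun u hu ↦ ?_)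
    have hu0 : 0 < u := hu
    have := Chebyshev.abs_psi_sub_theta_le_sqrt_mul_log (x := Real.exp u)
      (Real.one_le_exp hu0.le)
    rw [Real.log_exp, ← Real.exp_half] at this
    rw [Real.norm_eq_abs, abs_mul, abs_mul, Real.abs_exp, abs_of_nonneg (pow_nonneg hu0.le k)]
    calc _ ≤ u ^ k * (2 * Real.exp (u / 2) * u) * Real.exp (-u) := by gcongr
      _ = 2 * (u ^ (k + 1) * (Real.exp (u / 2) * Real.exp (-u))) := by ring
      _ = _ := by rw [← Real.exp_add]; congr 3; ring
  refine (h1.sub h2).congr ((ae_restrict_iff' measurableSet_Ioi).2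
    (Eventually.of_forall fun u hu ↦ ?_))
  simp only [Pi.sub_apply, psiErrWeighted, psiErr, Set.indicator_of_mem hu, Real.abs_exp,
    Real.log_exp, smul_eq_mul]
  rw [Real.exp_neg, show -1 * u = -u by ring, Real.exp_neg]
  field_simp
  ring

theorem one_third_le_log {x : ℝ} (hx : 3 / 2 ≤ x) : 1 / 3 ≤ Real.log x := by
  have h1 := Real.one_sub_inv_le_log_of_pos (by linarith : (0 : ℝ) < x)
  have h2 : x⁻¹ ≤ (3 / 2)⁻¹ := inv_anti₀ (by norm_num) hx
  norm_num at h2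
  linarith

theorem inv_log_pow_le (j : ℕ) : ∃ C : ℝ, 0 ≤ C ∧ ∀ Y x : ℝ, 1 < Y → 3 / 2 ≤ x →
    (Real.log x ^ j)⁻¹ ≤ C * (1 + √(Y / x)) / Real.log Y ^ j := by
  refine ⟨2 ^ (j - 1) * (1 + (6 * j) ^ j), by positivity, fun Y x hY hx ↦ ?_⟩
  have hx0 : 0 < x := by linarith
  have hL := one_third_le_log hx
  have hLY := Real.log_pos hY
  rcases Nat.eq_zero_or_pos j with rfl | hj
  · have := Real.sqrt_nonneg (Y / x)
    norm_num
    linarith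
  have hj0 : (0 : ℝ) < j := by exact_mod_cast hj
  have hq : 0 ≤ Y / x := by positivity
  set t := (Y / x) ^ (1 / (2 * j) : ℝ) with ht
  have ht0 : 0 ≤ t := by positivity
  have htj : t ^ j = √(Y / x) := by
    rw [ht, ← Real.rpow_natCast, ← Real.rpow_mul hq, Real.sqrt_eq_rpow]
    congr 1
    field_simp
  have h1 : Real.log Y ≤ Real.log x * (1 + 6 * j * t) := by
    have h2 : Real.log (Y / x) ≤ t / (1 / (2 * j)) :=
      Real.log_le_rpow_div hq (by positivity)
    rw [Real.log_div (by linarith) (by linarith)] at h2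
    have h3 : t / (1 / (2 * j)) = 1 / 3 * (6 * j * t) := by field_simp; ring
    have h4 : 1 / 3 * (6 * j * t) ≤ Real.log x * (6 * j * t) := by gcongr
    linarith
  have h2 : Real.log Y ^ j ≤ Real.log x ^ j * (2 ^ (j - 1) * (1 + (6 * j) ^ j * √(Y / x))) := by
    calc _ ≤ (Real.log x * (1 + 6 * j * t)) ^ j := by gcongr
      _ = Real.log x ^ j * (1 + 6 * j * t) ^ j := mul_pow _ _ _
      _ ≤ Real.log x ^ j * (2 ^ (j - 1) * (1 ^ j + (6 * j * t) ^ j)) := by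
          have : 0 ≤ Real.log x := by linarith
          gcongr
          exact add_pow_le zero_le_one (by positivity) j
      _ = _ := by rw [one_pow, mul_pow, htj]
  have hlx : 0 < Real.log x := by linarith
  rw [inv_eq_one_div, div_le_div_iff₀ (by positivity) (by positivity), one_mul]
  refine h2.trans ?_
  have : 0 ≤ √(Y / x) := Real.sqrt_nonneg _
  have : 1 + (6 * j : ℝ) ^ j * √(Y / x) ≤ (1 + (6 * j : ℝ) ^ j) * (1 + √(Y / x)) := by
    have : 0 ≤ (6 * j : ℝ) ^ j := by positivity
    nlinarith
  calc Real.log x ^ j * (2 ^ (j - 1) * (1 + (6 * j : ℝ) ^ j * √(Y / x)))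
      ≤ Real.log x ^ j * (2 ^ (j - 1) * ((1 + (6 * j : ℝ) ^ j) * (1 + √(Y / x)))) := by gcongr
    _ = _ := by ring

/-- The primes up to `b`. -/
def primesUpTo (b : ℝ) : Finset ℕ := {p ∈ Finset.Ioc 0 ⌊b⌋₊ | p.Prime}

theorem mem_primesUpTo {b : ℝ} {p : ℕ} : p ∈ primesUpTo b ↔ p.Prime ∧ (p : ℝ) ≤ b := by
  rw [primesUpTo, Finset.mem_filter, Finset.mem_Ioc]
  constructor
  · rintro ⟨⟨_, h⟩, hp⟩
    exact ⟨hp, (Nat.le_floor_iff' hp.ne_zero).1 h⟩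
  · rintro ⟨hp, h⟩
    exact ⟨⟨hp.pos, (Nat.le_floor_iff' hp.ne_zero).2 h⟩, hp⟩

theorem abs_theta_sub_self_le {b : ℝ} (hb : 0 ≤ b) : |Chebyshev.theta b - b| ≤ b := by
  have h1 := Chebyshev.theta_le_log4_mul_x hb
  have h2 := Chebyshev.theta_nonneg b
  have h3 : Real.log 4 ≤ 2 := by
    have := Real.log_two_lt_d9
    rw [show (4 : ℝ) = 2 ^ 2 by norm_num, Real.log_pow]
    push_cast
    linarith
  rw [abs_le]
  constructor <;> nlinarith

theorem sum_primesUpTo_log_mul {f f' : ℝ → ℂ} (hf : ∀ x, 3 / 2 ≤ x → HasDerivAt f (f' x) x)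
    (hf' : ContinuousOn f' (Set.Ici (3 / 2))) {b : ℝ} (hb : 3 / 2 ≤ b) :
    ∑ p ∈ primesUpTo b, Real.log p * f p - ∫ x in (3 / 2 : ℝ)..b, f x =
      f b * (Chebyshev.theta b - b : ℝ) + (3 / 2) * f (3 / 2) -
        ∫ x in (3 / 2 : ℝ)..b, f' x * (Chebyshev.theta x - x : ℝ) := by
  set c : ℕ → ℂ := fun k ↦ if k.Prime then (Real.log k : ℂ) else 0 with hc
  have hS : ∀ t : ℝ, ∑ k ∈ Finset.Icc 0 ⌊t⌋₊, c k = (Chebyshev.theta t : ℂ) := by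
    intro t
    rw [Chebyshev.theta, Finset.sum_filter, ← Finset.Ioc_insert_left (Nat.zero_le _),
      Finset.sum_insert (by simp)]
    push_cast
    simp only [hc, Nat.not_prime_zero, if_false, zero_add]
    exact Finset.sum_congr rfl fun k _ ↦ by split_ifs <;> simp
  have hcont : ContinuousOn f' (Set.Icc (3 / 2) b) := hf'.mono Set.Icc_subset_Ici_self
  have hcontf : ContinuousOn f (Set.Icc (3 / 2) b) :=
    fun x hx ↦ (hf x hx.1).continuousAt.continuousWithinAt
  have h1 := sum_mul_eq_sub_sub_integral_mul c (f := f) (a := 3 / 2) (b := b) (by norm_num) hb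
    (fun t ht ↦ (hf t ht.1).differentiableAt)
    ((hcont.integrableOn_Icc).congr_fun (fun t ht ↦ (hf t ht.1).deriv.symm) measurableSet_Icc)
  simp_rw [hS] at h1
  rw [Chebyshev.theta_eq_zero_of_lt_two (by norm_num : (3 / 2 : ℝ) < 2), show ⌊(3 / 2 : ℝ)⌋₊ = 1 by norm_num,
    Complex.ofReal_zero, mul_zero, sub_zero,
    ← intervalIntegral.integral_of_le hb] at h1
  have hd : ∫ x in (3 / 2 : ℝ)..b, deriv f x * (Chebyshev.theta x : ℂ) =
      ∫ x in (3 / 2 : ℝ)..b, f' x * (Chebyshev.theta x : ℂ) := by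
    refine intervalIntegral.integral_congr fun x hx ↦ ?_
    rw [Set.uIcc_of_le hb] at hx
    simp only [(hf x hx.1).deriv]
  have hs : ∑ k ∈ Finset.Ioc 1 ⌊b⌋₊, f k * c k = ∑ p ∈ primesUpTo b, Real.log p * f p := by
    rw [primesUpTo, Finset.sum_filter]
    have : Finset.Ioc 0 ⌊b⌋₊ = insert 1 (Finset.Ioc 1 ⌊b⌋₊) := by
      ext k
      have : 1 ≤ ⌊b⌋₊ := Nat.le_floor (by push_cast; linarith)
      simp only [Finset.mem_Ioc, Finset.mem_insert]
      omega
    rw [this, Finset.sum_insert (by simp), if_neg Nat.not_prime_one, zero_add]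
    refine Finset.sum_congr rfl fun k _ ↦ ?_
    simp only [hc]
    split_ifs <;> ring
  rw [hs, hd] at h1
  have hI1 : IntervalIntegrable f MeasureTheory.volume (3 / 2) b :=
    (by rwa [Set.uIcc_of_le hb] : ContinuousOn f (Set.uIcc (3 / 2) b)).intervalIntegrable
  have hI2 : IntervalIntegrable (fun x : ℝ ↦ f' x * x) MeasureTheory.volume (3 / 2) b := by
    refine ContinuousOn.intervalIntegrable ?_
    rw [Set.uIcc_of_le hb]
    exact hcont.mul Complex.continuous_ofReal.continuousOn
  have hI3 : IntervalIntegrable (fun x : ℝ ↦ f' x * (Chebyshev.theta x : ℂ))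
      MeasureTheory.volume (3 / 2) b := by
    refine IntervalIntegrable.continuousOn_mul ?_ (by rwa [Set.uIcc_of_le hb])
    have h : IntervalIntegrable Chebyshev.theta MeasureTheory.volume (3 / 2) b :=
      Chebyshev.theta_mono.intervalIntegrable
    exact ⟨MeasureTheory.Integrable.ofReal h.1, MeasureTheory.Integrable.ofReal h.2⟩
  have h2 : ∫ x in (3 / 2 : ℝ)..b, (f x + f' x * x) = f b * b - f (3 / 2) * (3 / 2 : ℝ) := by
    refine intervalIntegral.integral_eq_sub_of_hasDerivAt (f := fun x : ℝ ↦ f x * (x : ℂ))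
      (fun x hx ↦ ?_) (hI1.add hI2)
    rw [Set.uIcc_of_le hb] at hx
    refine ((hf x hx.1).mul (hasDerivAt_id x).ofReal_comp).congr_deriv ?_
    simp
    ring
  rw [intervalIntegral.integral_add hI1 hI2] at h2
  have h3 : ∫ x in (3 / 2 : ℝ)..b, f' x * (Chebyshev.theta x - x : ℝ) =
      (∫ x in (3 / 2 : ℝ)..b, f' x * (Chebyshev.theta x : ℂ)) - ∫ x in (3 / 2 : ℝ)..b, f' x * x := by
    rw [← intervalIntegral.integral_sub hI3 hI2]
    congr 1
    ext x
    push_cast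
    ring
  rw [h1, h3]
  push_cast at h2 ⊢
  linear_combination -h2

theorem norm_sum_primesUpTo_log_mul_sub_integral_le (k : ℕ) : ∃ K : ℝ, 0 ≤ K ∧
    ∀ (f f' : ℝ → ℂ) (M b : ℝ), 0 ≤ M → 3 / 2 ≤ b →
      (∀ x, 3 / 2 ≤ x → HasDerivAt f (f' x) x) → ContinuousOn f' (Set.Ici (3 / 2)) →
      (∀ x, 3 / 2 ≤ x → ‖f' x‖ ≤ M * Real.log x ^ k / x ^ 2) →
      ‖∑ p ∈ primesUpTo b, Real.log p * f p - ∫ x in (3 / 2 : ℝ)..b, f x‖ ≤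
        b * ‖f b‖ + 3 / 2 * ‖f (3 / 2)‖ + K * M := by
  set G : ℝ → ℝ := fun x ↦ Real.log x ^ k * (Chebyshev.theta x - x) / x ^ 2 with hG
  have hGi : MeasureTheory.IntegrableOn (fun x ↦ ‖G x‖) (Set.Ioi 1) :=
    MeasureTheory.Integrable.norm (integrableOn_theta_sub_self k)
  refine ⟨∫ x in Set.Ioi 1, ‖G x‖, MeasureTheory.integral_nonneg fun x ↦ norm_nonneg _,
    fun f f' M b hM hb hf hf' hbd ↦ ?_⟩
  rw [sum_primesUpTo_log_mul hf hf' hb]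
  have h1 : ‖∫ x in (3 / 2 : ℝ)..b, f' x * (Chebyshev.theta x - x : ℝ)‖ ≤
      (∫ x in Set.Ioi 1, ‖G x‖) * M := by
    rw [intervalIntegral.integral_of_le hb]
    have hsub : Set.Ioc (3 / 2) b ⊆ Set.Ioi 1 := fun x hx ↦ by
      have := hx.1
      simp only [Set.mem_Ioi]
      linarith
    calc _ ≤ ∫ x in Set.Ioc (3 / 2) b, ‖G x‖ * M := by
          refine MeasureTheory.norm_integral_le_of_norm_le
            ((hGi.mono_set hsub).mul_const M) ?_
          refine (MeasureTheory.ae_restrict_iff' measurableSet_Ioc).2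
            (Eventually.of_forall fun x hx ↦ ?_)
          have hL := one_third_le_log hx.1.le
          have hl : 0 < Real.log x := by linarith
          rw [norm_mul, Complex.norm_real, hG, norm_div, norm_mul, Real.norm_of_nonneg
            (by positivity : 0 ≤ Real.log x ^ k), Real.norm_of_nonneg (by positivity : 0 ≤ x ^ 2)]
          calc _ ≤ M * Real.log x ^ k / x ^ 2 * ‖Chebyshev.theta x - x‖ := by
                gcongr
                exact hbd x hx.1.le
            _ = _ := by ring
      _ = (∫ x in Set.Ioc (3 / 2) b, ‖G x‖) * M := MeasureTheory.integral_mul_const _ _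
      _ ≤ _ := by
          refine mul_le_mul_of_nonneg_right ?_ hM
          exact MeasureTheory.setIntegral_mono_set hGi (Eventually.of_forall fun _ ↦ norm_nonneg _)
            hsub.eventuallyLE
  refine (norm_sub_le _ _).trans (add_le_add ((norm_add_le _ _).trans (add_le_add ?_ ?_)) h1)
  · rw [norm_mul, Complex.norm_real, mul_comm]
    gcongr
    exact abs_theta_sub_self_le (by linarith)
  · rw [norm_mul]
    norm_num

theorem hasDerivAt_inv_mul_log {x : ℝ} (hx : 3 / 2 ≤ x) :
    HasDerivAt (fun x : ℝ ↦ (x * Real.log x)⁻¹)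
      (-(Real.log x + 1) / (x * Real.log x) ^ 2) x := by
  have hL := one_third_le_log hx
  have h := (hasDerivAt_id x).mul (Real.hasDerivAt_log (by linarith : x ≠ 0))
  have h2 := h.inv (by simp only [Pi.mul_apply, id]; positivity)
  refine h2.congr_deriv ?_
  have : x ≠ 0 := by linarith
  simp only [Pi.mul_apply, id]
  field_simp

theorem continuousOn_log_of_le : ContinuousOn Real.log (Set.Ici (3 / 2)) :=
  Real.continuousOn_log.mono fun x hx ↦ by
    have : (3 / 2 : ℝ) ≤ x := hx
    simp only [Set.mem_compl_iff, Set.mem_singleton_iff]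
    linarith

/-- Mertens' second theorem, up to a bounded error. -/
theorem sum_primesUpTo_inv : ∃ K : ℝ, ∀ b : ℝ, 3 / 2 ≤ b →
    |∑ p ∈ primesUpTo b, (p : ℝ)⁻¹ - Real.log (Real.log b)| ≤ K := by
  obtain ⟨K, hK0, hK⟩ := norm_sum_primesUpTo_log_mul_sub_integral_le 0
  refine ⟨3 + 3 / 2 * ‖(((3 / 2 : ℝ) * Real.log (3 / 2))⁻¹ : ℝ)‖ + K * 12 +
    |Real.log (Real.log (3 / 2))|, fun b hb ↦ ?_⟩
  have hlb := one_third_le_log hb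
  have hcl := continuousOn_log_of_le
  have hpos : ∀ x ∈ Set.Ici (3 / 2 : ℝ), x * Real.log x ≠ 0 := fun x hx ↦ by
    have h1 : 3 / 2 ≤ x := hx
    have := one_third_le_log hx
    positivity
  have h := hK (fun x ↦ (((x * Real.log x)⁻¹ : ℝ) : ℂ))
    (fun x ↦ ((-(Real.log x + 1) / (x * Real.log x) ^ 2 : ℝ) : ℂ)) 12 b (by norm_num) hb
    (fun x hx ↦ (hasDerivAt_inv_mul_log hx).ofReal_comp) (by
      refine Complex.continuous_ofReal.comp_continuousOn ?_
      exact ContinuousOn.div (hcl.add continuousOn_const).neg ((continuousOn_id.mul hcl).pow 2)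
        fun x hx ↦ pow_ne_zero 2 (hpos x hx)) (fun x hx ↦ by
      have hL := one_third_le_log hx
      have hx0 : 0 < x := by linarith
      rw [Complex.norm_real, norm_div, norm_neg, Real.norm_of_nonneg (by linarith),
        Real.norm_of_nonneg (by positivity), pow_zero, mul_one, div_le_div_iff₀ (by positivity)
          (by positivity)]
      have : Real.log x + 1 ≤ 12 * Real.log x ^ 2 := by nlinarith
      calc _ ≤ 12 * Real.log x ^ 2 * x ^ 2 := by gcongr
        _ = _ := by ring)
  have e1 : ∑ p ∈ primesUpTo b, (Real.log p : ℂ) * (((p * Real.log p)⁻¹ : ℝ) : ℂ) =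
      ((∑ p ∈ primesUpTo b, (p : ℝ)⁻¹ : ℝ) : ℂ) := by
    rw [Complex.ofReal_sum]
    refine Finset.sum_congr rfl fun p hp ↦ ?_
    have hp' := (mem_primesUpTo.1 hp).1.two_le
    have h1 : Real.log p ≠ 0 := (Real.log_pos (by exact_mod_cast hp')).ne'
    rw [← Complex.ofReal_mul, mul_inv_rev, mul_inv_cancel_left₀ h1]
  have e2 : ∫ x in (3 / 2 : ℝ)..b, (x * Real.log x)⁻¹ =
      Real.log (Real.log b) - Real.log (Real.log (3 / 2)) := by
    refine intervalIntegral.integral_eq_sub_of_hasDerivAt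
      (f := fun x ↦ Real.log (Real.log x)) (fun x hx ↦ ?_) ?_
    · rw [Set.uIcc_of_le hb] at hx
      have hL := one_third_le_log hx.1
      refine ((Real.hasDerivAt_log (by linarith [hx.1])).log (by linarith)).congr_deriv ?_
      rw [mul_inv, div_eq_mul_inv]
    · refine ContinuousOn.intervalIntegrable ?_
      rw [Set.uIcc_of_le hb]
      exact ((continuousOn_id.mul hcl).inv₀ hpos).mono Set.Icc_subset_Ici_self
  rw [e1, intervalIntegral.integral_ofReal, ← Complex.ofReal_sub, Complex.norm_real, e2,
    Real.norm_eq_abs, Complex.norm_real, Complex.norm_real] at h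
  have h3 : b * ‖(b * Real.log b)⁻¹‖ ≤ 3 := by
    have hb0 : 0 < b := by linarith
    rw [Real.norm_of_nonneg (by positivity), mul_inv, ← mul_assoc, mul_inv_cancel₀ hb0.ne', one_mul]
    rw [inv_le_comm₀ (by linarith) (by norm_num)]
    linarith
  have h4 := abs_sub_abs_le_abs_sub (∑ p ∈ primesUpTo b, (p : ℝ)⁻¹ - Real.log (Real.log b))
    (-Real.log (Real.log (3 / 2)))
  rw [abs_neg] at h4
  have e3 : ∑ p ∈ primesUpTo b, (p : ℝ)⁻¹ - Real.log (Real.log b) - -Real.log (Real.log (3 / 2)) =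
    ∑ p ∈ primesUpTo b, (p : ℝ)⁻¹ - (Real.log (Real.log b) - Real.log (Real.log (3 / 2))) := by ring
  rw [e3] at h4
  linarith

/-- Mertens' first theorem, as an upper bound. -/
theorem sum_primesUpTo_log_div : ∃ K : ℝ, 0 ≤ K ∧ ∀ b : ℝ, 3 / 2 ≤ b →
    ∑ p ∈ primesUpTo b, Real.log p / p ≤ Real.log b + K := by
  obtain ⟨K, hK0, hK⟩ := norm_sum_primesUpTo_log_mul_sub_integral_le 0
  refine ⟨2 + K, by positivity, fun b hb ↦ ?_⟩
  have hb0 : 0 < b := by linarith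
  have h := hK (fun x ↦ ((x⁻¹ : ℝ) : ℂ)) (fun x ↦ ((-(x ^ 2)⁻¹ : ℝ) : ℂ)) 1 b (by norm_num) hb
    (fun x hx ↦ (hasDerivAt_inv (by linarith)).ofReal_comp) (by
      refine Complex.continuous_ofReal.comp_continuousOn ?_
      refine ((continuousOn_id.pow 2).inv₀ fun x hx ↦ ?_).neg
      have : (3 / 2 : ℝ) ≤ x := hx
      exact pow_ne_zero 2 (by simp only [id]; linarith)) (fun x hx ↦ by
      rw [Complex.norm_real, norm_neg, Real.norm_of_nonneg (by positivity)]
      simp)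
  have e1 : ∑ p ∈ primesUpTo b, (Real.log p : ℂ) * (((p : ℝ)⁻¹ : ℝ) : ℂ) =
      ((∑ p ∈ primesUpTo b, Real.log p / p : ℝ) : ℂ) := by
    push_cast
    exact Finset.sum_congr rfl fun p hp ↦ by rw [div_eq_mul_inv]
  rw [e1, intervalIntegral.integral_ofReal, ← Complex.ofReal_sub, Complex.norm_real,
    integral_inv_of_pos (by norm_num) hb0, Real.norm_eq_abs, Complex.norm_real, Complex.norm_real,
    Real.norm_of_nonneg (by positivity), Real.norm_of_nonneg (by positivity),
    mul_inv_cancel₀ hb0.ne'] at h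
  have h2 : Real.log (b / (3 / 2)) ≤ Real.log b := by
    apply Real.log_le_log (by positivity)
    rw [div_le_iff₀ (by norm_num)]
    linarith
  have := (abs_le.1 h).2
  norm_num at this
  norm_num at h2
  linarith

/-- `∑_p e^{-sp}` over primes. -/
def primeExpSum (s : ℂ) : ℂ := ∑' p : Nat.Primes, Complex.exp (-(s * (p : ℕ)))

theorem summable_exp_neg_mul_nat {s : ℂ} (hs : 0 < s.re) :
    Summable fun n : ℕ ↦ Complex.exp (-(s * n)) := by
  have h : ‖Complex.exp (-s)‖ < 1 := by
    rw [Complex.norm_exp, Complex.neg_re]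
    exact (Real.exp_lt_exp.2 (by linarith : -s.re < 0)).trans_eq Real.exp_zero
  refine (summable_geometric_of_norm_lt_one h).congr fun n ↦ ?_
  rw [← Complex.exp_nat_mul]
  congr 1
  ring

theorem summable_primeExpSum {s : ℂ} (hs : 0 < s.re) :
    Summable fun p : Nat.Primes ↦ Complex.exp (-(s * (p : ℕ))) :=
  (summable_exp_neg_mul_nat hs).comp_injective Subtype.val_injective

theorem tendsto_sum_primesUpTo {s : ℂ} (hs : 0 < s.re) :
    Tendsto (fun n : ℕ ↦ ∑ p ∈ primesUpTo n, Complex.exp (-(s * p))) atTop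
      (𝓝 (primeExpSum s)) := by
  have h1 : HasSum (Set.indicator {p : ℕ | p.Prime} fun n : ℕ ↦ Complex.exp (-(s * n)))
      (primeExpSum s) :=
    (hasSum_subtype_iff_indicator (f := fun n : ℕ ↦ Complex.exp (-(s * n)))).1
      (summable_primeExpSum hs).hasSum
  refine ((tendsto_add_atTop_iff_nat 1).2 h1.tendsto_sum_nat).congr fun n ↦ ?_
  rw [primesUpTo, Nat.floor_natCast, Finset.sum_filter, Finset.range_eq_Ico,
    Finset.sum_eq_sum_Ico_succ_bot (by omega)]
  simp only [Set.indicator, Set.mem_ofPred_eq, Nat.not_prime_zero, if_false, zero_add]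
  rfl

theorem re_div_ofReal_eq {w : ℂ} (hw : w.re = 1) (Y : ℝ) : (w / Y).re = 1 / Y := by
  rw [Complex.div_ofReal_re, hw]

theorem norm_exp_neg_div_mul {w : ℂ} (hw : w.re = 1) (Y x : ℝ) :
    ‖Complex.exp (-(w / Y * x))‖ = Real.exp (-(x / Y)) := by
  rw [Complex.norm_exp, Complex.neg_re, Complex.re_mul_ofReal, re_div_ofReal_eq hw]
  congr 1
  ring

theorem hasDerivAt_exp_div_log (s : ℂ) {x : ℝ} (hx : 3 / 2 ≤ x) :
    HasDerivAt (fun x : ℝ ↦ Complex.exp (-(s * x)) * ((Real.log x)⁻¹ : ℝ))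
      (-s * Complex.exp (-(s * x)) * ((Real.log x)⁻¹ : ℝ) -
        Complex.exp (-(s * x)) * ((x * Real.log x ^ 2)⁻¹ : ℝ)) x := by
  have hL := one_third_le_log hx
  have h1 : HasDerivAt (fun x : ℝ ↦ Complex.exp (-(s * x)))
      (Complex.exp (-(s * x)) * (-(s * 1))) x :=
    (((hasDerivAt_id x).ofReal_comp).const_mul s).neg.cexp
  have h2 : HasDerivAt (fun x : ℝ ↦ (((Real.log x)⁻¹ : ℝ) : ℂ)) ((-x⁻¹ / Real.log x ^ 2 : ℝ) : ℂ) x :=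
    ((Real.hasDerivAt_log (by linarith)).inv (by linarith)).ofReal_comp
  refine (h1.mul h2).congr_deriv ?_
  rw [show -x⁻¹ / Real.log x ^ 2 = - (x * Real.log x ^ 2)⁻¹ by rw [mul_inv]; ring]
  push_cast
  ring

theorem sqrt_one_div_mul_self (v : ℝ) : √(1 / v) * v = √v := by
  rw [Real.sqrt_div zero_le_one, Real.sqrt_one, one_div, inv_mul_eq_div, Real.div_sqrt]

theorem sqrt_le_one_add {v : ℝ} (hv : 0 ≤ v) : √v ≤ 1 + v := by
  have := Real.sq_sqrt hv
  nlinarith [Real.sqrt_nonneg v, sq_nonneg (√v - 1)]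

theorem norm_deriv_exp_div_log_le (k : ℕ) : ∃ C : ℝ, 0 ≤ C ∧ ∀ (Y x : ℝ) (w : ℂ),
    1 < Y → 3 / 2 ≤ x → w.re = 1 →
    ‖-(w / Y) * Complex.exp (-(w / Y * x)) * ((Real.log x)⁻¹ : ℝ) -
        Complex.exp (-(w / Y * x)) * ((x * Real.log x ^ 2)⁻¹ : ℝ)‖ ≤
      (C * ‖w‖ * Y / Real.log Y ^ (k + 1)) * Real.log x ^ k / x ^ 2 := by
  obtain ⟨C, hC, hCb⟩ := inv_log_pow_le (k + 1)
  refine ⟨14 * C, by positivity, fun Y x w hY hx hw ↦ ?_⟩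
  have hY0 : 0 < Y := by linarith
  have hx0 : 0 < x := by linarith
  have hL := one_third_le_log hx
  have hl : 0 < Real.log x := by linarith
  have hLY := Real.log_pos hY
  have hw1 : 1 ≤ ‖w‖ := by
    have := Complex.abs_re_le_norm w
    rwa [hw, abs_one] at this
  have hb := hCb Y x hY hx
  set v := x / Y with hv
  have hv0 : 0 < v := by positivity
  have hYx : Y / x = 1 / v := by rw [hv]; field_simp
  rw [hYx] at hb
  have hxv : x = v * Y := by rw [hv]; field_simp
  set E := C / Real.log Y ^ (k + 1) with hE
  have hE0 : 0 ≤ E := by positivity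
  have hb' : (Real.log x ^ (k + 1))⁻¹ ≤ E * (1 + √(1 / v)) := by
    rw [hE]
    calc _ ≤ _ := hb
      _ = _ := by ring
  have hsv := sqrt_one_div_mul_self v
  have hsl := sqrt_le_one_add hv0.le
  have hexp1 : v ≤ Real.exp v := by linarith [Real.add_one_le_exp v]
  have hexp2 : v ^ 2 / 2 ≤ Real.exp v := by
    have := Real.quadratic_le_exp_of_nonneg hv0.le
    linarith
  have hexp0 : 1 ≤ Real.exp v := Real.one_le_exp hv0.le
  have hinv : Real.exp (-v) * Real.exp v = 1 := by rw [← Real.exp_add]; simp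
  have hen : 0 < Real.exp (-v) := Real.exp_pos _
  have g1 : Real.exp (-v) * (v ^ 2 * (1 + √(1 / v))) ≤ 5 := by
    have : v ^ 2 * (1 + √(1 / v)) ≤ 5 * Real.exp v := by nlinarith
    nlinarith
  have g2 : Real.exp (-v) * (v * (1 + √(1 / v))) ≤ 3 := by
    have : v * (1 + √(1 / v)) ≤ 3 * Real.exp v := by nlinarith
    nlinarith
  have i1 : (Real.log x)⁻¹ = Real.log x ^ k * (Real.log x ^ (k + 1))⁻¹ := by
    field_simp
    ring
  have i2 : (Real.log x ^ 2)⁻¹ ≤ 3 * (Real.log x)⁻¹ := by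
    rw [← one_div, ← div_eq_mul_inv, div_le_div_iff₀ (by positivity) (by positivity)]
    nlinarith
  have t1 : ‖-(w / Y) * Complex.exp (-(w / Y * x)) * ((Real.log x)⁻¹ : ℝ)‖ ≤
      5 * E * ‖w‖ * Y * Real.log x ^ k / x ^ 2 := by
    rw [norm_mul, norm_mul, norm_exp_neg_div_mul hw, norm_neg, norm_div, Complex.norm_real,
      Complex.norm_real, Real.norm_of_nonneg hY0.le, Real.norm_of_nonneg (by positivity), i1,
      le_div_iff₀ (by positivity)]
    calc ‖w‖ / Y * Real.exp (-v) * (Real.log x ^ k * (Real.log x ^ (k + 1))⁻¹) * x ^ 2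
        ≤ ‖w‖ / Y * Real.exp (-v) * (Real.log x ^ k * (E * (1 + √(1 / v)))) * x ^ 2 := by gcongr
      _ = ‖w‖ * Y * Real.log x ^ k * E * (Real.exp (-v) * (v ^ 2 * (1 + √(1 / v)))) := by
          rw [hxv]; field_simp
      _ ≤ ‖w‖ * Y * Real.log x ^ k * E * 5 := by gcongr
      _ = _ := by ring
  have t2 : ‖Complex.exp (-(w / Y * x)) * ((x * Real.log x ^ 2)⁻¹ : ℝ)‖ ≤
      9 * E * ‖w‖ * Y * Real.log x ^ k / x ^ 2 := by
    rw [norm_mul, norm_exp_neg_div_mul hw, Complex.norm_real, Real.norm_of_nonneg (by positivity),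
      le_div_iff₀ (by positivity), mul_inv]
    calc Real.exp (-v) * (x⁻¹ * (Real.log x ^ 2)⁻¹) * x ^ 2
        ≤ Real.exp (-v) * (x⁻¹ * (3 * (Real.log x ^ k * (E * (1 + √(1 / v)))))) * x ^ 2 := by
          gcongr
          refine i2.trans ?_
          rw [i1]
          gcongr
      _ = 3 * Y * Real.log x ^ k * E * (Real.exp (-v) * (v * (1 + √(1 / v)))) := by
          rw [hxv]; field_simp
      _ ≤ 3 * Y * Real.log x ^ k * E * 3 := by gcongr
      _ = 9 * E * 1 * Y * Real.log x ^ k := by ring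
      _ ≤ _ := by gcongr
  refine (norm_sub_le _ _).trans ((add_le_add t1 t2).trans (le_of_eq ?_))
  rw [hE]
  ring

theorem integrableOn_exp_div_log {Y : ℝ} (hY : 0 < Y) {w : ℂ} (hw : w.re = 1) :
    MeasureTheory.IntegrableOn
      (fun x : ℝ ↦ Complex.exp (-(w / Y * x)) * ((Real.log x)⁻¹ : ℝ)) (Set.Ioi (3 / 2)) := by
  have h1 : MeasureTheory.IntegrableOn (fun x : ℝ ↦ 3 * Real.exp (-(1 / Y) * x)) (Set.Ioi (3 / 2)) :=
    (integrableOn_exp_mul_Ioi (by simpa using hY) _).const_mul 3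
  refine h1.mono' (ContinuousOn.aestronglyMeasurable ?_ measurableSet_Ioi) ?_
  · exact fun x hx ↦ (hasDerivAt_exp_div_log (w / Y) (le_of_lt hx)).continuousAt.continuousWithinAt
  · refine (MeasureTheory.ae_restrict_iff' measurableSet_Ioi).2 (Eventually.of_forall fun x hx ↦ ?_)
    have hL := one_third_le_log (le_of_lt hx)
    rw [norm_mul, norm_exp_neg_div_mul hw, Complex.norm_real, Real.norm_of_nonneg
      (by simp only [inv_nonneg]; linarith), mul_comm, show -(x / Y) = -(1 / Y) * x by ring]
    gcongr
    rw [inv_le_comm₀ (by linarith) (by norm_num)]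
    linarith

theorem norm_primeExpSum_sub_integral_le (k : ℕ) : ∃ C : ℝ, 0 ≤ C ∧ ∀ (Y : ℝ) (w : ℂ),
    1 < Y → w.re = 1 →
    ‖primeExpSum (w / Y) -
        ∫ x in Set.Ioi (3 / 2 : ℝ), Complex.exp (-(w / Y * x)) * ((Real.log x)⁻¹ : ℝ)‖ ≤
      9 / 2 + C * ‖w‖ * Y / Real.log Y ^ (k + 1) := by
  obtain ⟨C, hC, hCb⟩ := norm_deriv_exp_div_log_le k
  obtain ⟨K, hK, hKb⟩ := norm_sum_primesUpTo_log_mul_sub_integral_le k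
  refine ⟨K * C, by positivity, fun Y w hY hw ↦ ?_⟩
  have hY0 : 0 < Y := by linarith
  have hLY := Real.log_pos hY
  set f : ℝ → ℂ := fun x ↦ Complex.exp (-(w / Y * x)) * ((Real.log x)⁻¹ : ℝ) with hf
  have hs : 0 < (w / Y).re := by rw [re_div_ofReal_eq hw]; positivity
  have hfb : ∀ x : ℝ, 3 / 2 ≤ x → ‖f x‖ ≤ 3 * Real.exp (-(x / Y)) := fun x hx ↦ by
    have hL := one_third_le_log hx
    simp only [hf]
    rw [norm_mul, norm_exp_neg_div_mul hw, Complex.norm_real, Real.norm_of_nonneg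
      (by simp only [inv_nonneg]; linarith), mul_comm]
    gcongr
    rw [inv_le_comm₀ (by linarith) (by norm_num)]
    linarith
  have hcl := continuousOn_log_of_le
  have key : ∀ n : ℕ, 2 ≤ n →
      ‖∑ p ∈ primesUpTo n, Complex.exp (-(w / Y * p)) - ∫ x in (3 / 2 : ℝ)..n, f x‖ ≤
        3 * Y * ((n : ℝ) / Y * Real.exp (-(n / Y))) + 9 / 2 + K * C * ‖w‖ * Y / Real.log Y ^ (k + 1) := by
    intro n hn
    have hn' : (3 / 2 : ℝ) ≤ n := by
      have : (2 : ℝ) ≤ n := by exact_mod_cast hn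
      linarith
    have h := hKb f _ (C * ‖w‖ * Y / Real.log Y ^ (k + 1)) n (by positivity) hn'
      (fun x hx ↦ hasDerivAt_exp_div_log (w / Y) hx) (by
        have hne : ∀ x ∈ Set.Ici (3 / 2 : ℝ), Real.log x ≠ 0 := fun x hx ↦ by
          have := one_third_le_log hx
          linarith
        have hexp : ContinuousOn (fun x : ℝ ↦ Complex.exp (-(w / Y * x))) (Set.Ici (3 / 2)) := by
          fun_prop
        have hli : ContinuousOn (fun x : ℝ ↦ (((Real.log x)⁻¹ : ℝ) : ℂ)) (Set.Ici (3 / 2)) :=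
          Complex.continuous_ofReal.comp_continuousOn (hcl.inv₀ hne)
        have hli2 : ContinuousOn (fun x : ℝ ↦ (((x * Real.log x ^ 2)⁻¹ : ℝ) : ℂ))
            (Set.Ici (3 / 2)) :=
          Complex.continuous_ofReal.comp_continuousOn
            ((continuousOn_id.mul (hcl.pow 2)).inv₀ fun x hx ↦ by
              have h1 : (3 / 2 : ℝ) ≤ x := hx
              exact mul_ne_zero (by simp only [id]; linarith) (pow_ne_zero 2 (hne x hx)))
        exact ((continuousOn_const.mul hexp).mul hli).sub (hexp.mul hli2))
      (fun x hx ↦ hCb Y x w hY hx hw)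
    have e : ∑ p ∈ primesUpTo n, Real.log p * f p =
        ∑ p ∈ primesUpTo n, Complex.exp (-(w / Y * p)) := by
      refine Finset.sum_congr rfl fun p hp ↦ ?_
      have hp' := (mem_primesUpTo.1 hp).1.two_le
      have h1 : (Real.log p : ℂ) ≠ 0 :=
        Complex.ofReal_ne_zero.2 (Real.log_pos (by exact_mod_cast hp')).ne'
      simp only [hf]
      rw [Complex.ofReal_inv, mul_comm, mul_assoc, inv_mul_cancel₀ h1, mul_one]
      simp
    rw [e] at h
    refine h.trans ?_
    have b1 := hfb n hn'
    have b2 := hfb (3 / 2) le_rfl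
    have b3 : Real.exp (-(3 / 2 / Y)) ≤ 1 := Real.exp_le_one_iff.2 (by
      rw [neg_nonpos]; positivity)
    have b4 : (n : ℝ) * ‖f n‖ ≤ n * (3 * Real.exp (-(n / Y))) := by gcongr
    have b5 : 3 * Y * ((n : ℝ) / Y * Real.exp (-(n / Y))) = n * (3 * Real.exp (-(n / Y))) := by
      field_simp
    have b6 : K * (C * ‖w‖ * Y / Real.log Y ^ (k + 1)) = K * C * ‖w‖ * Y / Real.log Y ^ (k + 1) := by
      ring
    rw [b5, b6]
    linarith
  have l1 := (tendsto_sum_primesUpTo hs).sub (MeasureTheory.intervalIntegral_tendsto_integral_Ioi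
    (3 / 2 : ℝ) (integrableOn_exp_div_log hY0 hw) tendsto_natCast_atTop_atTop)
  have l2 : Tendsto (fun n : ℕ ↦ 3 * Y * ((n : ℝ) / Y * Real.exp (-(n / Y))) + 9 / 2 +
      K * C * ‖w‖ * Y / Real.log Y ^ (k + 1)) atTop
      (𝓝 (3 * Y * 0 + 9 / 2 + K * C * ‖w‖ * Y / Real.log Y ^ (k + 1))) := by
    refine (((Tendsto.const_mul _ ?_).add_const _).add_const _)
    have := (Real.tendsto_pow_mul_exp_neg_atTop_nhds_zero 1).comp
      ((tendsto_natCast_atTop_atTop (R := ℝ)).atTop_div_const hY0)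
    refine this.congr fun n ↦ ?_
    simp
  have := le_of_tendsto_of_tendsto l1.norm l2 (eventually_atTop.2 ⟨2, key⟩)
  rwa [mul_zero, zero_add] at this

theorem abs_log_le_rpow {v : ℝ} (hv : 0 < v) :
    |Real.log v| ≤ 4 * (v ^ (1 / 4 : ℝ) + v ^ (-(1 / 4) : ℝ)) := by
  have h1 := Real.log_le_rpow_div hv.le (by norm_num : (0 : ℝ) < 1 / 4)
  have h2 := Real.log_le_rpow_div (inv_pos.2 hv).le (by norm_num : (0 : ℝ) < 1 / 4)
  rw [Real.log_inv, Real.inv_rpow hv.le, ← Real.rpow_neg hv.le] at h2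
  have := Real.rpow_pos_of_pos hv (1 / 4)
  have := Real.rpow_pos_of_pos hv (-(1 / 4))
  rw [abs_le]
  constructor <;> linarith

theorem integrableOn_exp_neg_mul_log_majorant :
    MeasureTheory.IntegrableOn (fun v : ℝ ↦ Real.exp (-v) *
      (4 * (v ^ (1 / 4 : ℝ) + v ^ (-(1 / 4) : ℝ)) * (1 + √(1 / v)))) (Set.Ioi 0) := by
  have a1 := Real.GammaIntegral_convergent (by norm_num : (0 : ℝ) < 5 / 4)
  have a2 := Real.GammaIntegral_convergent (by norm_num : (0 : ℝ) < 3 / 4)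
  have a3 := Real.GammaIntegral_convergent (by norm_num : (0 : ℝ) < 1 / 4)
  refine MeasureTheory.IntegrableOn.congr_fun
    (((a1.add a2).add (a2.add a3)).const_mul 4) (fun v hv ↦ ?_) measurableSet_Ioi
  have hv' : 0 < v := hv
  have e : √(1 / v) = v ^ (-(1 / 2) : ℝ) := by
    rw [Real.sqrt_eq_rpow, one_div v, Real.inv_rpow hv'.le, Real.rpow_neg hv'.le]
  have e1 : v ^ (1 / 4 : ℝ) * v ^ (-(1 / 2) : ℝ) = v ^ (-(1 / 4) : ℝ) := by
    rw [← Real.rpow_add hv']; norm_num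
  have e2 : v ^ (-(1 / 4) : ℝ) * v ^ (-(1 / 2) : ℝ) = v ^ (-(3 / 4) : ℝ) := by
    rw [← Real.rpow_add hv']; norm_num
  simp only [Pi.add_apply]
  rw [e]
  norm_num
  norm_num at e1 e2
  linear_combination (-4 * Real.exp (-v)) * e1 - 4 * Real.exp (-v) * e2

theorem norm_integral_exp_div_log_sub_le : ∃ C : ℝ, 0 ≤ C ∧ ∀ (Y : ℝ) (w : ℂ),
    1 < Y → w.re = 1 →
    ‖(∫ x in Set.Ioi (3 / 2 : ℝ), Complex.exp (-(w / Y * x)) * ((Real.log x)⁻¹ : ℝ)) -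
        ∫ x in Set.Ioi (3 / 2 : ℝ), Complex.exp (-(w / Y * x)) * ((Real.log Y)⁻¹ : ℝ)‖ ≤
      C * Y / Real.log Y ^ 2 := by
  obtain ⟨C, hC, hCb⟩ := inv_log_pow_le 1
  set h : ℝ → ℝ := fun v ↦ Real.exp (-v) *
      (4 * (v ^ (1 / 4 : ℝ) + v ^ (-(1 / 4) : ℝ)) * (1 + √(1 / v))) with hh
  have hnn : ∀ v : ℝ, 0 ≤ v → 0 ≤ h v := fun v hv ↦ by simp only [hh]; positivity
  have hi : MeasureTheory.IntegrableOn h (Set.Ioi 0) := integrableOn_exp_neg_mul_log_majorant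
  refine ⟨C * ∫ v in Set.Ioi 0, h v, mul_nonneg hC (MeasureTheory.setIntegral_nonneg
    measurableSet_Ioi fun v hv ↦ hnn v (le_of_lt hv)), fun Y w hY hw ↦ ?_⟩
  have hY0 : 0 < Y := by linarith
  have hLY := Real.log_pos hY
  have i1 := integrableOn_exp_div_log hY0 hw
  have hs : 0 < (w / Y).re := by rw [re_div_ofReal_eq hw]; positivity
  have i2 : MeasureTheory.IntegrableOn (fun x : ℝ ↦ Complex.exp (-(w / Y * x)) *
      ((Real.log Y)⁻¹ : ℝ)) (Set.Ioi (3 / 2)) := by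
    refine MeasureTheory.Integrable.mul_const ?_ _
    have := integrableOn_exp_mul_complex_Ioi (a := -(w / Y)) (by simpa using hs) (3 / 2)
    simp only [neg_mul] at this
    exact this
  rw [← MeasureTheory.integral_sub i1 i2]
  have j1 : MeasureTheory.IntegrableOn (fun x ↦ h (x / Y)) (Set.Ioi 0) := by
    have := (MeasureTheory.integrableOn_Ioi_comp_mul_left_iff h 0 (inv_pos.2 hY0)).2
      (by simpa using hi)
    simpa only [inv_mul_eq_div] using this
  have j2 : ∫ x in Set.Ioi 0, h (x / Y) = Y * ∫ v in Set.Ioi 0, h v := by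
    have := MeasureTheory.integral_comp_mul_left_Ioi h 0 (inv_pos.2 hY0)
    simpa only [inv_mul_eq_div, mul_zero, inv_inv, smul_eq_mul, zero_div] using this
  have hsub : Set.Ioi (3 / 2 : ℝ) ⊆ Set.Ioi 0 := Set.Ioi_subset_Ioi (by norm_num)
  calc _ ≤ ∫ x in Set.Ioi (3 / 2 : ℝ), h (x / Y) * (C / Real.log Y ^ 2) := by
        refine MeasureTheory.norm_integral_le_of_norm_le ((j1.mono_set hsub).mul_const _)
          ((MeasureTheory.ae_restrict_iff' measurableSet_Ioi).2
            (Eventually.of_forall fun x hx ↦ ?_))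
        have hx' : 3 / 2 ≤ x := le_of_lt hx
        have hx0 : 0 < x := by linarith
        have hL := one_third_le_log hx'
        have hl : 0 < Real.log x := by linarith
        rw [← mul_sub, ← Complex.ofReal_sub, norm_mul, norm_exp_neg_div_mul hw, Complex.norm_real]
        simp only [hh]
        rw [mul_assoc]
        gcongr
        have e : (Real.log x)⁻¹ - (Real.log Y)⁻¹ =
            -Real.log (x / Y) * ((Real.log x)⁻¹ * (Real.log Y)⁻¹) := by
          rw [Real.log_div hx0.ne' hY0.ne']
          field_simp
          ring
        have hb := hCb Y x hY hx'
        rw [pow_one, pow_one, show Y / x = 1 / (x / Y) by field_simp] at hb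
        rw [e, norm_mul, norm_neg, Real.norm_eq_abs, Real.norm_of_nonneg (by positivity)]
        calc _ ≤ 4 * ((x / Y) ^ (1 / 4 : ℝ) + (x / Y) ^ (-(1 / 4) : ℝ)) *
              (C * (1 + √(1 / (x / Y))) / Real.log Y * (Real.log Y)⁻¹) := by
              gcongr
              exact abs_log_le_rpow (by positivity)
          _ = _ := by ring
    _ = (∫ x in Set.Ioi (3 / 2 : ℝ), h (x / Y)) * (C / Real.log Y ^ 2) :=
        MeasureTheory.integral_mul_const _ _
    _ ≤ (∫ x in Set.Ioi (0 : ℝ), h (x / Y)) * (C / Real.log Y ^ 2) := by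
        refine mul_le_mul_of_nonneg_right ?_ (by positivity)
        refine MeasureTheory.setIntegral_mono_set j1 ?_ hsub.eventuallyLE
        exact (MeasureTheory.ae_restrict_iff' measurableSet_Ioi).2
          (Eventually.of_forall fun x hx ↦ hnn _ (div_nonneg (le_of_lt hx) hY0.le))
    _ = _ := by rw [j2]; ring

theorem norm_exp_sub_one_le_two_mul {z : ℂ} (hz : z.re ≤ 0) : ‖Complex.exp z - 1‖ ≤ 2 * ‖z‖ := by
  rcases le_total ‖z‖ 1 with h | h
  · exact Complex.norm_exp_sub_one_le h
  · refine (norm_sub_le _ _).trans ?_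
    rw [Complex.norm_exp, norm_one]
    linarith [Real.exp_le_one_iff.2 hz]

theorem sq_log_le {Y : ℝ} (hY : 1 ≤ Y) : Real.log Y ^ 2 ≤ 4 * Y := by
  have h := Real.log_le_rpow_div (by linarith : 0 ≤ Y) (by norm_num : (0 : ℝ) < 1 / 2)
  rw [← Real.sqrt_eq_rpow] at h
  have h0 := Real.log_nonneg hY
  have h1 := Real.sq_sqrt (by linarith : 0 ≤ Y)
  calc Real.log Y ^ 2 ≤ (√Y / (1 / 2)) ^ 2 := by gcongr
    _ = 4 * √Y ^ 2 := by ring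
    _ = _ := by rw [h1]

/-- The prime number theorem on a vertical line close to the origin. -/
theorem norm_primeExpSum_sub_le (D : ℝ) (n : ℕ) : ∃ C : ℝ, 0 ≤ C ∧ ∀ (Y : ℝ) (w : ℂ),
    1 < Y → w.re = 1 → ‖w‖ ≤ D * Real.log Y ^ n →
    ‖primeExpSum (w / Y) - Y / (w * Real.log Y)‖ ≤ C * Y / Real.log Y ^ 2 := by
  obtain ⟨C₁, hC₁, h₁⟩ := norm_primeExpSum_sub_integral_le (n + 1)
  obtain ⟨C₂, hC₂, h₂⟩ := norm_integral_exp_div_log_sub_le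
  refine ⟨18 + C₁ * |D| + C₂ + 6, by positivity, fun Y w hY hw hwD ↦ ?_⟩
  have hY0 : 0 < Y := by linarith
  have hLY := Real.log_pos hY
  have b1 := h₁ Y w hY hw
  have b2 := h₂ Y w hY hw
  have hs : 0 < (w / Y).re := by rw [re_div_ofReal_eq hw]; positivity
  have hw0 : w ≠ 0 := by
    rintro rfl
    simp at hw
  have hYc : (Y : ℂ) ≠ 0 := Complex.ofReal_ne_zero.2 hY0.ne'
  have hLc : (Real.log Y : ℂ) ≠ 0 := Complex.ofReal_ne_zero.2 hLY.ne'
  have e : ∫ x in Set.Ioi (3 / 2 : ℝ), Complex.exp (-(w / Y * x)) * ((Real.log Y)⁻¹ : ℝ) =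
      Complex.exp (-(w / Y * (3 / 2 : ℝ))) / (w / Y) * ((Real.log Y)⁻¹ : ℝ) := by
    rw [MeasureTheory.integral_mul_const]
    congr 1
    have := integral_exp_mul_complex_Ioi (a := -(w / Y)) (by simpa using hs) (3 / 2)
    simp only [neg_mul] at this
    rw [this]
    rw [neg_div_neg_eq]
  rw [e] at b2
  have sq := sq_log_le hY.le
  have b3 : ‖Complex.exp (-(w / Y * (3 / 2 : ℝ))) / (w / Y) * ((Real.log Y)⁻¹ : ℝ) -
      Y / (w * Real.log Y)‖ ≤ 3 / Real.log Y := by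
    have : Complex.exp (-(w / Y * (3 / 2 : ℝ))) / (w / Y) * ((Real.log Y)⁻¹ : ℝ) -
      Y / (w * Real.log Y) =
        (Complex.exp (-(w / Y * (3 / 2 : ℝ))) - 1) / (w / Y) * ((Real.log Y)⁻¹ : ℝ) := by
      push_cast
      field_simp
    rw [this, norm_mul, norm_div, Complex.norm_real, Real.norm_of_nonneg (by positivity),
      div_eq_mul_inv 3 (Real.log Y)]
    gcongr
    rw [div_le_iff₀ (norm_pos_iff.2 (div_ne_zero hw0 hYc))]
    refine (norm_exp_sub_one_le_two_mul ?_).trans (le_of_eq ?_)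
    · rw [Complex.neg_re, Complex.re_mul_ofReal]
      nlinarith
    · rw [norm_neg, norm_mul, Complex.norm_real]
      norm_num
      ring
  have c0 : (9 / 2 : ℝ) ≤ 18 * Y / Real.log Y ^ 2 := by
    rw [le_div_iff₀ (by positivity)]
    linarith
  have c1 : C₁ * ‖w‖ * Y / Real.log Y ^ (n + 1 + 1) ≤ C₁ * |D| * Y / Real.log Y ^ 2 := by
    rw [div_le_div_iff₀ (by positivity) (by positivity)]
    have : ‖w‖ ≤ |D| * Real.log Y ^ n := hwD.trans (by gcongr; exact le_abs_self D)
    calc _ ≤ C₁ * (|D| * Real.log Y ^ n) * Y * Real.log Y ^ 2 := by gcongr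
      _ = _ := by ring
  have c3 : 3 / Real.log Y ≤ 6 * Y / Real.log Y ^ 2 := by
    rw [div_le_div_iff₀ (by positivity) (by positivity)]
    have : Real.log Y ≤ Y := by linarith [Real.log_le_sub_one_of_pos hY0]
    nlinarith
  have tri : ∀ a b c d : ℂ, ‖a - d‖ ≤ ‖a - b‖ + ‖b - c‖ + ‖c - d‖ := fun a b c d ↦ by
    have := norm_sub_le_norm_sub_add_norm_sub a b d
    have := norm_sub_le_norm_sub_add_norm_sub b c d
    linarith
  refine (tri _ _ _ _).trans ((add_le_add (add_le_add b1 b2) b3).trans ?_)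
  calc _ ≤ (18 * Y / Real.log Y ^ 2 + C₁ * |D| * Y / Real.log Y ^ 2) + C₂ * Y / Real.log Y ^ 2 +
        6 * Y / Real.log Y ^ 2 := by gcongr
    _ = _ := by ring

/-- `∑_{p, q} e^{-spq}` over pairs of primes. -/
def primePairExpSum (s : ℂ) : ℂ :=
  ∑' x : Nat.Primes × Nat.Primes, Complex.exp (-(s * ((x.1 : ℕ) * (x.2 : ℕ))))

theorem summable_exp_neg_mul_primes {a : ℝ} (ha : 0 < a) :
    Summable fun p : Nat.Primes ↦ Real.exp (-(a * (p : ℕ))) := by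
  have h := (summable_primeExpSum (s := a) (by simpa using ha)).norm
  refine h.congr fun p ↦ ?_
  rw [Complex.norm_exp]
  simp

theorem summable_primePair_majorant {a : ℝ} (ha : 0 < a) :
    Summable fun x : Nat.Primes × Nat.Primes ↦
      Real.exp (-(a * (x.1 : ℕ))) * Real.exp (-(a * (x.2 : ℕ))) :=
  (summable_exp_neg_mul_primes ha).mul_of_nonneg (summable_exp_neg_mul_primes ha)
    (fun _ ↦ (Real.exp_pos _).le) fun _ ↦ (Real.exp_pos _).le

theorem norm_exp_primePair (s : ℂ) (p q : ℕ) :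
    ‖Complex.exp (-(s * (p * q)))‖ = Real.exp (-(s.re * (p * q))) := by
  rw [Complex.norm_exp, Complex.neg_re]
  rw [← Nat.cast_mul, ← Nat.cast_mul, ← Complex.ofReal_natCast, Complex.re_mul_ofReal]

theorem norm_exp_primePair_le {s : ℂ} (hs : 0 < s.re) (p q : Nat.Primes) :
    ‖Complex.exp (-(s * ((p : ℕ) * (q : ℕ))))‖ ≤
      Real.exp (-(s.re * (p : ℕ))) * Real.exp (-(s.re * (q : ℕ))) := by
  rw [norm_exp_primePair, ← Real.exp_add, Real.exp_le_exp]
  have hp : (2 : ℝ) ≤ (p : ℕ) := by exact_mod_cast p.2.two_le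
  have hq : (2 : ℝ) ≤ (q : ℕ) := by exact_mod_cast q.2.two_le
  have : ((p : ℕ) : ℝ) + (q : ℕ) ≤ (p : ℕ) * (q : ℕ) := by nlinarith
  nlinarith

theorem summable_primePairExpSum {s : ℂ} (hs : 0 < s.re) :
    Summable fun x : Nat.Primes × Nat.Primes ↦
      Complex.exp (-(s * ((x.1 : ℕ) * (x.2 : ℕ)))) :=
  Summable.of_norm_bounded (summable_primePair_majorant hs)
    fun x ↦ norm_exp_primePair_le hs x.1 x.2

theorem tsum_ite_le_eq_sum_primesUpTo {s : ℂ} (hs : 0 < s.re) (Q : ℝ) :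
    ∑' x : Nat.Primes × Nat.Primes,
        (if ((x.1 : ℕ) : ℝ) ≤ Q then Complex.exp (-(s * ((x.1 : ℕ) * (x.2 : ℕ)))) else 0) =
      ∑ p ∈ primesUpTo Q, primeExpSum (s * p) := by
  have hsum : Summable fun x : Nat.Primes × Nat.Primes ↦
      (if ((x.1 : ℕ) : ℝ) ≤ Q then Complex.exp (-(s * ((x.1 : ℕ) * (x.2 : ℕ)))) else 0) := by
    refine Summable.of_norm_bounded (summable_primePairExpSum hs).norm fun x ↦ ?_
    split_ifs
    · exact le_rfl
    · simp
  rw [hsum.tsum_prod]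
  have e : ∀ p : Nat.Primes, ∑' q : Nat.Primes,
      (if ((p : ℕ) : ℝ) ≤ Q then Complex.exp (-(s * ((p : ℕ) * (q : ℕ)))) else 0) =
      (fun n : ℕ ↦ if (n : ℝ) ≤ Q then primeExpSum (s * n) else 0) p := fun p ↦ by
    simp only [primeExpSum]
    split_ifs
    · exact tsum_congr fun q ↦ by rw [mul_assoc]
    · exact tsum_zero
  simp_rw [e]
  refine (tsum_subtype {p : ℕ | p.Prime}
    (fun n : ℕ ↦ if (n : ℝ) ≤ Q then primeExpSum (s * n) else 0)).trans ?_
  rw [tsum_eq_sum (s := primesUpTo Q)]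
  · refine Finset.sum_congr rfl fun p hp ↦ ?_
    obtain ⟨h1, h2⟩ := mem_primesUpTo.1 hp
    rw [Set.indicator_of_mem (by exact h1), if_pos h2]
  · intro p hp
    rw [mem_primesUpTo, not_and] at hp
    rw [Set.indicator_apply]
    split_ifs with h1 h2
    · exact absurd h2 (hp h1)
    · rfl
    · rfl

theorem norm_primePair_hyperbola_le {X : ℝ} (hX : 0 < X) {s : ℂ} (hs : s.re = 1 / X) (p q : ℕ) :
    ‖Complex.exp (-(s * (p * q))) -
        (if (p : ℝ) ≤ √X then Complex.exp (-(s * (p * q))) else 0) -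
        (if (q : ℝ) ≤ √X then Complex.exp (-(s * (p * q))) else 0)‖ ≤
      Real.exp 1 * (Real.exp (-(1 / √X * p)) * Real.exp (-(1 / √X * q))) := by
  have hQ : 0 < √X := Real.sqrt_pos.2 hX
  have hQ2 : √X * √X = X := Real.mul_self_sqrt hX.le
  have key : 0 ≤ ((p : ℝ) - √X) * (q - √X) →
      ‖Complex.exp (-(s * (p * q)))‖ ≤
      Real.exp 1 * (Real.exp (-(1 / √X * p)) * Real.exp (-(1 / √X * q))) := fun h ↦ by
    rw [norm_exp_primePair, ← Real.exp_add, ← Real.exp_add, Real.exp_le_exp, hs]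
    have : 1 + (-(1 / √X * p) + -(1 / √X * q)) + 1 / X * (p * q) =
        ((p : ℝ) - √X) * (q - √X) / X := by
      have h1 : (1 : ℝ) / √X = √X / X := by
        rw [div_eq_div_iff hQ.ne' hX.ne', one_mul, hQ2]
      rw [h1, eq_div_iff hX.ne']
      field_simp
      linear_combination -hQ2
    have h2 : 0 ≤ ((p : ℝ) - √X) * (q - √X) / X := by positivity
    linarith
  split_ifs with h1 h2 h2
  · rw [sub_self, zero_sub, norm_neg]
    exact key (mul_nonneg_of_nonpos_of_nonpos (by linarith) (by linarith))
  · rw [sub_self, sub_zero, norm_zero]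
    positivity
  · rw [sub_zero, sub_self, norm_zero]
    positivity
  · rw [sub_zero, sub_zero]
    exact key (mul_nonneg (by linarith) (by linarith))

theorem norm_primePairExpSum_sub_le {X : ℝ} (hX : 0 < X) {s : ℂ} (hs : s.re = 1 / X) :
    ‖primePairExpSum s - 2 * ∑ p ∈ primesUpTo √X, primeExpSum (s * p)‖ ≤
      Real.exp 1 * ‖primeExpSum ((1 : ℂ) / (√X : ℝ))‖ ^ 2 := by
  have hs0 : 0 < s.re := by rw [hs]; positivity
  have hQ : 0 < 1 / √X := by positivity
  have hS := summable_primePairExpSum hs0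
  have h1 : Summable fun x : Nat.Primes × Nat.Primes ↦
      (if ((x.1 : ℕ) : ℝ) ≤ √X then Complex.exp (-(s * ((x.1 : ℕ) * (x.2 : ℕ)))) else 0) := by
    refine Summable.of_norm_bounded hS.norm fun x ↦ ?_
    split_ifs
    · exact le_rfl
    · simp
  have h2 : Summable fun x : Nat.Primes × Nat.Primes ↦
      (if ((x.2 : ℕ) : ℝ) ≤ √X then Complex.exp (-(s * ((x.1 : ℕ) * (x.2 : ℕ)))) else 0) := by
    refine Summable.of_norm_bounded hS.norm fun x ↦ ?_
    split_ifs
    · exact le_rfl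
    · simp
  have e2 : ∑' x : Nat.Primes × Nat.Primes,
      (if ((x.2 : ℕ) : ℝ) ≤ √X then Complex.exp (-(s * ((x.1 : ℕ) * (x.2 : ℕ)))) else 0) =
      ∑ p ∈ primesUpTo √X, primeExpSum (s * p) := by
    rw [← tsum_ite_le_eq_sum_primesUpTo hs0, ← (Equiv.prodComm Nat.Primes Nat.Primes).tsum_eq]
    refine tsum_congr fun x ↦ ?_
    simp only [Equiv.prodComm_apply, Prod.fst_swap, Prod.snd_swap]
    rw [mul_comm ((x.2 : ℕ) : ℂ)]
    congr
  have e : primePairExpSum s - 2 * ∑ p ∈ primesUpTo √X, primeExpSum (s * p) =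
      ∑' x : Nat.Primes × Nat.Primes, (Complex.exp (-(s * ((x.1 : ℕ) * (x.2 : ℕ)))) -
        (if ((x.1 : ℕ) : ℝ) ≤ √X then Complex.exp (-(s * ((x.1 : ℕ) * (x.2 : ℕ)))) else 0) -
        (if ((x.2 : ℕ) : ℝ) ≤ √X then Complex.exp (-(s * ((x.1 : ℕ) * (x.2 : ℕ)))) else 0)) := by
    rw [(hS.sub h1).tsum_sub h2, hS.tsum_sub h1, e2, tsum_ite_le_eq_sum_primesUpTo hs0,
      primePairExpSum]
    ring
  have e3 : ‖primeExpSum ((1 : ℂ) / (√X : ℝ))‖ =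
      ∑' p : Nat.Primes, Real.exp (-(1 / √X * (p : ℕ))) := by
    have : primeExpSum ((1 : ℂ) / (√X : ℝ)) =
        ((∑' p : Nat.Primes, Real.exp (-(1 / √X * (p : ℕ))) : ℝ) : ℂ) := by
      rw [Complex.ofReal_tsum, primeExpSum]
      refine tsum_congr fun p ↦ ?_
      push_cast
      rfl
    rw [this, Complex.norm_real, Real.norm_of_nonneg (tsum_nonneg fun _ ↦ (Real.exp_pos _).le)]
  have hq := summable_exp_neg_mul_primes hQ
  rw [e, e3, sq, hq.tsum_mul_tsum hq (summable_primePair_majorant hQ), ← tsum_mul_left]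
  exact tsum_of_norm_bounded ((summable_primePair_majorant hQ).mul_left _).hasSum
    fun x ↦ norm_primePair_hyperbola_le hX hs _ _

theorem sum_primesUpTo_sqrt_div_log : ∃ K : ℝ, 0 ≤ K ∧ ∀ X : ℝ, 1 < X → 2 ≤ Real.log X →
    |∑ p ∈ primesUpTo √X, (p * Real.log (X / p))⁻¹ - Real.log (Real.log X) / Real.log X| ≤
      K / Real.log X := by
  obtain ⟨K₁, h₁⟩ := sum_primesUpTo_inv
  obtain ⟨K₂, hK₂, h₂⟩ := sum_primesUpTo_log_div
  refine ⟨1 + K₂ + (|K₁| + 1), by positivity, fun X hX hl ↦ ?_⟩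
  have hX0 : 0 < X := by linarith
  have hL : 0 < Real.log X := by linarith
  have hQ : 0 < √X := Real.sqrt_pos.2 hX0
  have hlQ : Real.log √X = Real.log X / 2 := Real.log_sqrt hX0.le
  have hQ2 : 3 / 2 ≤ √X := by
    have := Real.log_le_sub_one_of_pos hQ
    linarith
  have m1 := h₁ √X hQ2
  have m2 := h₂ √X hQ2
  rw [hlQ] at m1 m2
  rw [Real.log_div hL.ne' two_ne_zero] at m1
  have hp : ∀ p ∈ primesUpTo √X, 0 < (p : ℝ) ∧ 0 ≤ Real.log p ∧
      Real.log (X / p) = Real.log X - Real.log p ∧ Real.log X / 2 ≤ Real.log (X / p) := by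
    intro p hp
    obtain ⟨h1, h2⟩ := mem_primesUpTo.1 hp
    have h3 : (0 : ℝ) < p := by exact_mod_cast h1.pos
    have h4 := Real.log_div hX0.ne' h3.ne'
    have h5 := Real.log_le_log h3 h2
    refine ⟨h3, Real.log_natCast_nonneg p, h4, ?_⟩
    rw [h4]
    linarith
  have e : ∑ p ∈ primesUpTo √X, (p * Real.log (X / p))⁻¹ - Real.log (Real.log X) / Real.log X =
      ∑ p ∈ primesUpTo √X, ((p * Real.log (X / p))⁻¹ - (p : ℝ)⁻¹ / Real.log X) +
      (∑ p ∈ primesUpTo √X, (p : ℝ)⁻¹ - Real.log (Real.log X)) / Real.log X := by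
    rw [Finset.sum_sub_distrib, ← Finset.sum_div]
    ring
  rw [e, add_div]
  refine (abs_add_le _ _).trans (add_le_add ?_ ?_)
  · refine (Finset.abs_sum_le_sum_abs _ _).trans ?_
    calc _ ≤ ∑ p ∈ primesUpTo √X, Real.log p / p * (2 / Real.log X ^ 2) := by
          refine Finset.sum_le_sum fun p hpm ↦ ?_
          obtain ⟨h1, h2, h3, h4⟩ := hp p hpm
          have h5 : 0 < Real.log (X / p) := by linarith
          have : (p * Real.log (X / p))⁻¹ - (p : ℝ)⁻¹ / Real.log X =
              Real.log p / p * ((Real.log X)⁻¹ * (Real.log (X / p))⁻¹) := by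
            have : Real.log p = Real.log X - Real.log (X / p) := by linarith
            rw [this]
            field_simp
          rw [this, abs_of_nonneg (by positivity)]
          gcongr
          calc (Real.log X)⁻¹ * (Real.log (X / p))⁻¹ ≤ (Real.log X)⁻¹ * (Real.log X / 2)⁻¹ := by
                gcongr
            _ = _ := by field_simp
      _ = (∑ p ∈ primesUpTo √X, Real.log p / p) * (2 / Real.log X ^ 2) := by rw [Finset.sum_mul]
      _ ≤ (Real.log X / 2 + K₂) * (2 / Real.log X ^ 2) := by gcongr
      _ ≤ (1 + K₂) / Real.log X := by
          rw [mul_div_assoc', div_le_div_iff₀ (by positivity) hL]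
          nlinarith [mul_nonneg hK₂ hL.le, mul_nonneg (mul_nonneg hK₂ hL.le) (sub_nonneg.2 hl)]
  · rw [abs_div, abs_of_pos hL]
    gcongr
    have := Real.log_two_lt_d9
    have := Real.log_two_gt_d9
    have := le_abs_self K₁
    have := abs_le.1 m1
    rw [abs_le]
    constructor <;> linarith

theorem norm_primePairExpSum_sub_main_le (D : ℝ) (n : ℕ) : ∃ C : ℝ, 0 ≤ C ∧
    ∀ (X : ℝ) (w : ℂ), 1 < X → 2 ≤ Real.log X → w.re = 1 → ‖w‖ ≤ D * Real.log X ^ n →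
    ‖primePairExpSum (w / X) - 2 * X * Real.log (Real.log X) / (w * Real.log X)‖ ≤
      C * X / Real.log X := by
  obtain ⟨C₁, hC₁, h₁⟩ := norm_primeExpSum_sub_le 1 0
  obtain ⟨C₂, hC₂, h₂⟩ := norm_primeExpSum_sub_le (|D| * 2 ^ n) n
  obtain ⟨K₁, hK₁⟩ := sum_primesUpTo_inv
  obtain ⟨K₂, hK₂, hK₂b⟩ := sum_primesUpTo_sqrt_div_log
  refine ⟨Real.exp 1 * (1 + C₁) ^ 2 * 4 + (2 * (4 * C₂ * (1 + |K₁|)) + 2 * K₂), by positivity,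
    fun X w hX hl hw hwD ↦ ?_⟩
  have hX0 : 0 < X := by linarith
  have hL : 0 < Real.log X := by linarith
  have hQ : 0 < √X := Real.sqrt_pos.2 hX0
  have hlQ : Real.log √X = Real.log X / 2 := Real.log_sqrt hX0.le
  have hQ2 : 3 / 2 ≤ √X := by
    have := Real.log_le_sub_one_of_pos hQ
    linarith
  have hw0 : w ≠ 0 := by
    rintro rfl
    simp at hw
  have hw1 : 1 ≤ ‖w‖ := by
    have := Complex.abs_re_le_norm w
    rwa [hw, abs_one] at this
  have b1 := norm_primePairExpSum_sub_le hX0 (re_div_ofReal_eq hw X)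
  have b2 : ‖primeExpSum ((1 : ℂ) / (√X : ℝ))‖ ≤ (1 + C₁) * √X / (Real.log X / 2) := by
    have h := h₁ √X 1 (by linarith) (by simp) (by simp)
    rw [hlQ] at h
    have h3 := norm_sub_norm_le (primeExpSum ((1 : ℂ) / (√X : ℝ)))
      ((√X : ℝ) / (1 * ((Real.log X / 2 : ℝ) : ℂ)))
    have h4 : ‖((√X : ℝ) : ℂ) / (1 * ((Real.log X / 2 : ℝ) : ℂ))‖ = √X / (Real.log X / 2) := by
      rw [one_mul, norm_div, Complex.norm_real, Complex.norm_real, Real.norm_of_nonneg hQ.le,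
        Real.norm_of_nonneg (by positivity)]
    rw [h4] at h3
    have h5 : C₁ * √X / (Real.log X / 2) ^ 2 ≤ C₁ * √X / (Real.log X / 2) := by
      gcongr
      nlinarith
    have : (1 + C₁) * √X / (Real.log X / 2) = √X / (Real.log X / 2) + C₁ * √X / (Real.log X / 2) := by
      ring
    linarith
  have b3 : ‖primePairExpSum (w / X) - 2 * ∑ p ∈ primesUpTo √X, primeExpSum (w / X * p)‖ ≤
      Real.exp 1 * (1 + C₁) ^ 2 * 4 * X / Real.log X := by
    refine b1.trans ?_
    calc _ ≤ Real.exp 1 * ((1 + C₁) * √X / (Real.log X / 2)) ^ 2 := by gcongr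
      _ = Real.exp 1 * (1 + C₁) ^ 2 * 4 * √X ^ 2 / Real.log X ^ 2 := by field_simp; ring
      _ = Real.exp 1 * (1 + C₁) ^ 2 * 4 * X / Real.log X ^ 2 := by rw [Real.sq_sqrt hX0.le]
      _ ≤ _ := by
          gcongr
          nlinarith
  have b4 : ‖∑ p ∈ primesUpTo √X, primeExpSum (w / X * p) -
      X / w * (∑ p ∈ primesUpTo √X, (p * Real.log (X / p))⁻¹ : ℝ)‖ ≤
      4 * C₂ * (1 + |K₁|) * X / Real.log X := by
    rw [Complex.ofReal_sum, Finset.mul_sum, ← Finset.sum_sub_distrib]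
    refine (norm_sum_le _ _).trans ?_
    calc _ ≤ ∑ p ∈ primesUpTo √X, (p : ℝ)⁻¹ * (4 * C₂ * X / Real.log X ^ 2) := by
          refine Finset.sum_le_sum fun p hpm ↦ ?_
          obtain ⟨g1, g2⟩ := mem_primesUpTo.1 hpm
          have g3 : (0 : ℝ) < p := by exact_mod_cast g1.pos
          have g4 := Real.log_div hX0.ne' g3.ne'
          have g5 := Real.log_le_log g3 g2
          have g6 : Real.log X / 2 ≤ Real.log (X / p) := by rw [g4]; linarith
          have g7 : 0 < Real.log (X / p) := by linarith
          have g8 : 1 < X / p := by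
            rw [one_lt_div g3]
            have := Real.mul_self_sqrt hX0.le
            nlinarith
          have h := h₂ (X / p) w g8 hw (hwD.trans (by
            calc D * Real.log X ^ n ≤ |D| * (2 * Real.log (X / p)) ^ n := by
                  gcongr
                  · exact le_abs_self D
                  · linarith
              _ = _ := by rw [mul_pow]; ring))
          have e1 : w / ((X / p : ℝ) : ℂ) = w / X * p := by
            push_cast
            rw [div_div_eq_mul_div]
            ring
          have e2 : ((X / p : ℝ) : ℂ) / (w * Real.log (X / p)) =
              X / w * ((p * Real.log (X / p))⁻¹ : ℝ) := by
            rw [Complex.ofReal_inv, Complex.ofReal_mul, Complex.ofReal_div]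
            push_cast
            rw [mul_inv, div_div, mul_comm w, ← div_div, ← div_div]
            ring
          rw [e1, e2] at h
          refine h.trans ?_
          calc C₂ * (X / p) / Real.log (X / p) ^ 2 ≤ C₂ * (X / p) / (Real.log X / 2) ^ 2 := by
                gcongr
            _ = _ := by field_simp; ring
      _ = (∑ p ∈ primesUpTo √X, (p : ℝ)⁻¹) * (4 * C₂ * X / Real.log X ^ 2) := by
          rw [Finset.sum_mul]
      _ ≤ ((1 + |K₁|) * Real.log X) * (4 * C₂ * X / Real.log X ^ 2) := by
          gcongr
          have m1 := (abs_le.1 (hK₁ √X hQ2)).2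
          rw [hlQ] at m1
          have m2 := Real.log_le_sub_one_of_pos (by positivity : 0 < Real.log X / 2)
          have m3 := le_abs_self K₁
          have m4 : 0 ≤ |K₁| := abs_nonneg _
          nlinarith
      _ = _ := by field_simp
  have b5 : ‖X / w * (∑ p ∈ primesUpTo √X, (p * Real.log (X / p))⁻¹ : ℝ) -
      X / w * (Real.log (Real.log X) / Real.log X : ℝ)‖ ≤ K₂ * X / Real.log X := by
    rw [← mul_sub, ← Complex.ofReal_sub, norm_mul, norm_div, Complex.norm_real, Complex.norm_real,
      Real.norm_of_nonneg hX0.le, Real.norm_eq_abs]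
    calc _ ≤ X / 1 * (K₂ / Real.log X) := by
          gcongr
          exact hK₂b X hX hl
      _ = _ := by ring
  have e : primePairExpSum (w / X) - 2 * X * Real.log (Real.log X) / (w * Real.log X) =
      (primePairExpSum (w / X) - 2 * ∑ p ∈ primesUpTo √X, primeExpSum (w / X * p)) +
      (2 * (∑ p ∈ primesUpTo √X, primeExpSum (w / X * p) -
        X / w * (∑ p ∈ primesUpTo √X, (p * Real.log (X / p))⁻¹ : ℝ)) +
      2 * (X / w * (∑ p ∈ primesUpTo √X, (p * Real.log (X / p))⁻¹ : ℝ) -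
        X / w * (Real.log (Real.log X) / Real.log X : ℝ))) := by
    have : (2 * X * Real.log (Real.log X) / (w * Real.log X) : ℂ) =
        2 * (X / w * (Real.log (Real.log X) / Real.log X : ℝ)) := by
      rw [Complex.ofReal_div]
      ring
    rw [this]
    ring
  rw [e]
  refine (norm_add_le _ _).trans ((add_le_add b3 ((norm_add_le _ _).trans ?_)).trans_eq
    (?_ : _ + (2 * (4 * C₂ * (1 + |K₁|) * X / Real.log X) + 2 * (K₂ * X / Real.log X)) = _))
  · rw [norm_mul, norm_mul, Complex.norm_ofNat]
    gcongr
  · ring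

theorem tsum_exp_neg_mul_primes_le {a : ℝ} (ha : 0 < a) :
    ∑' p : Nat.Primes, Real.exp (-(a * (p : ℕ))) ≤ 1 / a := by
  have hlt : Real.exp (-a) < 1 := Real.exp_lt_one_iff.2 (by linarith)
  have hg : HasSum (fun n : ℕ ↦ Real.exp (-a) * Real.exp (-a) ^ n)
      (Real.exp (-a) * (1 - Real.exp (-a))⁻¹) :=
    (hasSum_geometric_of_lt_one (Real.exp_pos _).le hlt).mul_left _
  have hinj : Function.Injective fun p : Nat.Primes ↦ (p : ℕ) - 1 := fun p q h ↦ by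
    have h1 := p.2.pos
    have h2 := q.2.pos
    apply Subtype.ext
    simp only at h
    omega
  have h1 : ∑' p : Nat.Primes, Real.exp (-(a * (p : ℕ))) ≤
      Real.exp (-a) * (1 - Real.exp (-a))⁻¹ := by
    rw [← hg.tsum_eq]
    refine (summable_exp_neg_mul_primes ha).tsum_le_tsum_of_inj _ hinj
      (fun n _ ↦ by positivity) (fun p ↦ le_of_eq ?_) hg.summable
    rw [← pow_succ', Nat.sub_add_cancel p.2.pos, ← Real.exp_nat_mul]
    congr 1
    ring
  refine h1.trans ?_
  rw [← div_eq_mul_inv, div_le_div_iff₀ (by linarith) ha, one_mul]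
  have h2 := Real.add_one_le_exp a
  have h3 : Real.exp (-a) * Real.exp a = 1 := by rw [← Real.exp_add]; simp
  nlinarith [Real.exp_pos (-a)]

theorem norm_primePairExpSum_le {s : ℂ} (hs : 0 < s.re) :
    ‖primePairExpSum s‖ ≤ (1 / s.re) ^ 2 := by
  have hq := summable_exp_neg_mul_primes hs
  refine (tsum_of_norm_bounded (summable_primePair_majorant hs).hasSum
    fun x ↦ norm_exp_primePair_le hs x.1 x.2).trans ?_
  rw [← hq.tsum_mul_tsum hq (summable_primePair_majorant hs), ← sq]
  have := tsum_exp_neg_mul_primes_le hs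
  have : 0 ≤ ∑' p : Nat.Primes, Real.exp (-(s.re * (p : ℕ))) :=
    tsum_nonneg fun _ ↦ (Real.exp_pos _).le
  gcongr

theorem PhiP2C_exp_neg {s : ℂ} (hs : 0 < s.re) :
    PhiP2C (Complex.exp (-s)) = ∑' j : ℕ+, (1 / (j : ℂ)) * primePairExpSum (s * (j : ℕ)) := by
  refine tsum_congr fun j ↦ ?_
  have hj : 0 < (s * (j : ℕ)).re := by
    rw [← Complex.ofReal_natCast, Complex.re_mul_ofReal]
    have := j.pos
    positivity
  rw [primePairExpSum, (summable_primePairExpSum hj).tsum_prod, ← tsum_mul_left]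
  refine tsum_congr fun p ↦ ?_
  rw [← tsum_mul_left]
  refine tsum_congr fun q ↦ ?_
  rw [← Complex.exp_nat_mul]
  congr 2
  push_cast
  ring

theorem hasSum_one_div_pnat_sq : HasSum (fun j : ℕ+ ↦ 1 / ((j : ℕ) : ℂ) ^ 2) (zeta2 : ℂ) := by
  have h1 : (zeta2 : ℂ) = ((π ^ 2 / 6 : ℝ) : ℂ) := by
    rw [zeta2, riemannZeta_two]
    norm_cast
  have h2 := (hasSum_nat_add_iff' 1).2 hasSum_zeta_two
  simp only [Finset.sum_range_one, Nat.cast_zero, ne_eq, OfNat.ofNat_ne_zero, not_false_eq_true,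
    zero_pow, div_zero, sub_zero] at h2
  have h3 : HasSum (fun j : ℕ+ ↦ 1 / ((j : ℕ) : ℝ) ^ 2) (π ^ 2 / 6) := by
    have h4 : (fun n : ℕ ↦ 1 / ((n + 1 : ℕ) : ℝ) ^ 2) ∘ Equiv.pnatEquivNat =
        fun j : ℕ+ ↦ 1 / ((j : ℕ) : ℝ) ^ 2 := by
      ext j
      rw [Function.comp_apply, Equiv.pnatEquivNat_apply, PNat.natPred_add_one]
    rw [← h4]
    exact Equiv.pnatEquivNat.hasSum_iff.2 h2
  rw [h1]
  convert Complex.hasSum_ofReal.2 h3 using 2 with j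
  push_cast
  rfl

theorem abs_log_div_sub_log_div_le {a b : ℝ} (hb : 1 ≤ b) (ha : b / 4 ≤ a) (hab : a ≤ b) :
    |Real.log a / a - Real.log b / b| ≤ 20 * (b - a) / b := by
  have hb0 : 0 < b := by linarith
  have ha0 : 0 < a := by linarith
  have h1 : Real.log b - Real.log a ≤ 4 * (b - a) / b := by
    rw [← Real.log_div hb0.ne' ha0.ne']
    refine (Real.log_le_sub_one_of_pos (by positivity)).trans ?_
    rw [div_sub_one ha0.ne', div_le_div_iff₀ ha0 hb0]
    nlinarith
  have h2 : Real.log a ≤ Real.log b := Real.log_le_log ha0 hab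
  have h3 : Real.log b ≤ b := by linarith [Real.log_le_sub_one_of_pos hb0]
  have h4 := Real.log_nonneg hb
  have e : Real.log a / a - Real.log b / b =
      Real.log b * (b - a) / (a * b) - (Real.log b - Real.log a) / a := by
    field_simp
    ring
  have h5 : Real.log b * (b - a) / (a * b) ≤ 4 * (b - a) / b := by
    rw [div_le_div_iff₀ (by positivity) hb0]
    have : Real.log b * b ≤ 4 * (a * b) := by nlinarith
    nlinarith
  have h6 : (Real.log b - Real.log a) / a ≤ 16 * (b - a) / b := by
    rw [div_le_iff₀ ha0]
    refine h1.trans ?_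
    rw [div_mul_eq_mul_div, div_le_div_iff_of_pos_right hb0]
    nlinarith
  have h7 : 0 ≤ Real.log b * (b - a) / (a * b) :=
    div_nonneg (mul_nonneg h4 (by linarith)) (by positivity)
  have h8 : 0 ≤ (Real.log b - Real.log a) / a := div_nonneg (by linarith) ha0.le
  have h9 : 20 * (b - a) / b = 4 * (b - a) / b + 16 * (b - a) / b := by ring
  have h10 : 0 ≤ (b - a) / b := div_nonneg (by linarith) hb0.le
  rw [e, h9, abs_le]
  constructor <;> linarith

theorem norm_primePairExpSum_mul_sub_le (D : ℝ) (n : ℕ) : ∃ C : ℝ, 0 ≤ C ∧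
    ∀ (X : ℝ) (w : ℂ) (j : ℕ), 1 < X → 8 ≤ Real.log X → w.re = 1 → ‖w‖ ≤ D * Real.log X ^ n →
    1 ≤ j →
    ‖1 / (j : ℂ) * primePairExpSum (w / X * j) -
        1 / (j : ℂ) ^ 2 * (2 * X * Real.log (Real.log X) / (w * Real.log X))‖ ≤
      C * X / Real.log X * (j : ℝ) ^ (-(3 / 2) : ℝ) := by
  obtain ⟨C, hC, hCb⟩ := norm_primePairExpSum_sub_main_le (|D| * 4 ^ n) n
  refine ⟨8 * C + 80 + 24, by positivity, fun X w j hX hl hw hwD hj ↦ ?_⟩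
  have hX0 : 0 < X := by linarith
  have hL : 0 < Real.log X := by linarith
  have hj1 : (1 : ℝ) ≤ j := by exact_mod_cast hj
  have hj0 : (0 : ℝ) < j := by linarith
  have hjc : (j : ℂ) ≠ 0 := by
    rw [← Complex.ofReal_natCast]
    exact Complex.ofReal_ne_zero.2 hj0.ne'
  have hw1 : 1 ≤ ‖w‖ := by
    have := Complex.abs_re_le_norm w
    rwa [hw, abs_one] at this
  have hr : (j : ℝ) ^ (-(3 / 2) : ℝ) = (j : ℝ)⁻¹ ^ 2 * √j := by
    rw [Real.sqrt_eq_rpow, ← Real.rpow_natCast, Real.inv_rpow hj0.le, ← Real.rpow_neg hj0.le,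
      ← Real.rpow_add hj0]
    norm_num
  have hsj : 1 ≤ √(j : ℝ) := Real.one_le_sqrt.2 hj1
  have hsq : √(j : ℝ) ^ 2 = j := Real.sq_sqrt hj0.le
  have hLL : Real.log (Real.log X) ≤ Real.log X := by
    linarith [Real.log_le_sub_one_of_pos hL]
  have hLL0 : 0 ≤ Real.log (Real.log X) := Real.log_nonneg (by linarith)
  rw [hr]
  rcases le_or_gt (Real.log j) (3 / 4 * Real.log X) with hc | hc
  · have hlX : Real.log (X / j) = Real.log X - Real.log j := Real.log_div hX0.ne' hj0.ne'
    have hlj := Real.log_nonneg hj1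
    have hX1 : 1 < X / j := (Real.log_pos_iff (by positivity)).1 (by rw [hlX]; linarith)
    have h := hCb (X / j) w hX1 (by rw [hlX]; linarith) hw (hwD.trans (by
      calc D * Real.log X ^ n ≤ |D| * (4 * Real.log (X / j)) ^ n := by
            gcongr
            · exact le_abs_self D
            · rw [hlX]; linarith
        _ = _ := by rw [mul_pow]; ring))
    have hw2 : w / ((X / j : ℝ) : ℂ) = w / X * j := by
      push_cast
      rw [div_div_eq_mul_div]
      ring
    rw [hw2] at h
    have hd := abs_log_div_sub_log_div_le (by linarith : 1 ≤ Real.log X)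
      (by rw [hlX]; linarith : Real.log X / 4 ≤ Real.log (X / j)) (by rw [hlX]; linarith)
    rw [show Real.log X - Real.log (X / j) = Real.log j by rw [hlX]; ring] at hd
    have hlj2 : Real.log j ≤ 2 * √j := by
      have := Real.log_le_rpow_div hj0.le (by norm_num : (0 : ℝ) < 1 / 2)
      rw [← Real.sqrt_eq_rpow] at this
      linarith
    have e : 1 / (j : ℂ) * primePairExpSum (w / X * j) -
        1 / (j : ℂ) ^ 2 * (2 * X * Real.log (Real.log X) / (w * Real.log X)) =
        1 / (j : ℂ) * (primePairExpSum (w / X * j) -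
          2 * ((X / j : ℝ) : ℂ) * Real.log (Real.log (X / j)) / (w * Real.log (X / j))) +
        1 / (j : ℂ) ^ 2 * (2 * X / w) * ((Real.log (Real.log (X / j)) / Real.log (X / j) -
          Real.log (Real.log X) / Real.log X : ℝ) : ℂ) := by
      rw [Complex.ofReal_sub, Complex.ofReal_div, Complex.ofReal_div, Complex.ofReal_div,
        Complex.ofReal_natCast]
      field_simp
      ring
    rw [e]
    have b1 : ‖1 / (j : ℂ) * (primePairExpSum (w / X * j) -
          2 * ((X / j : ℝ) : ℂ) * Real.log (Real.log (X / j)) / (w * Real.log (X / j)))‖ ≤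
        4 * C * X / Real.log X * ((j : ℝ)⁻¹ ^ 2 * √j) := by
      rw [norm_mul, norm_div, norm_one, Complex.norm_natCast]
      calc _ ≤ 1 / j * (C * (X / j) / Real.log (X / j)) := by gcongr
        _ ≤ 1 / j * (C * (X / j) / (Real.log X / 4)) := by
            gcongr
            rw [hlX]; linarith
        _ = 4 * C * X / Real.log X * ((j : ℝ)⁻¹ ^ 2 * 1) := by field_simp
        _ ≤ _ := by gcongr
    have b2 : ‖1 / (j : ℂ) ^ 2 * (2 * X / w) * ((Real.log (Real.log (X / j)) / Real.log (X / j) -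
          Real.log (Real.log X) / Real.log X : ℝ) : ℂ)‖ ≤
        80 * X / Real.log X * ((j : ℝ)⁻¹ ^ 2 * √j) := by
      rw [norm_mul, norm_mul, norm_div, norm_div, norm_pow, norm_one, Complex.norm_natCast,
        norm_mul, Complex.norm_ofNat, Complex.norm_real, Complex.norm_real, Real.norm_of_nonneg hX0.le,
        Real.norm_eq_abs]
      calc _ ≤ 1 / (j : ℝ) ^ 2 * (2 * X / 1) * (20 * (2 * √j) / Real.log X) := by
            gcongr
            refine hd.trans ?_
            gcongr
        _ = _ := by field_simp; ring
    refine (norm_add_le _ _).trans ((add_le_add b1 b2).trans ?_)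
    have : 0 ≤ C * X / Real.log X * ((j : ℝ)⁻¹ ^ 2 * √j) := by positivity
    have : 0 ≤ X / Real.log X * ((j : ℝ)⁻¹ ^ 2 * √j) := by positivity
    have e1 : (8 * C + 80 + 24) * X / Real.log X * ((j : ℝ)⁻¹ ^ 2 * √j) =
      8 * (C * X / Real.log X * ((j : ℝ)⁻¹ ^ 2 * √j)) + 80 * X / Real.log X * ((j : ℝ)⁻¹ ^ 2 * √j) +
      24 * (X / Real.log X * ((j : ℝ)⁻¹ ^ 2 * √j)) := by ring
    have e2 : 4 * C * X / Real.log X * ((j : ℝ)⁻¹ ^ 2 * √j) =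
      4 * (C * X / Real.log X * ((j : ℝ)⁻¹ ^ 2 * √j)) := by ring
    rw [e1, e2]
    linarith
  · set u := X ^ (1 / 8 : ℝ) with hu
    have hu1 : 1 ≤ u := Real.one_le_rpow hX.le (by norm_num)
    have hu8 : u ^ 8 = X := by
      rw [hu, ← Real.rpow_natCast, ← Real.rpow_mul hX0.le]
      norm_num
    have hLu : Real.log X ≤ 8 * u := by
      have := Real.log_le_rpow_div hX0.le (by norm_num : (0 : ℝ) < 1 / 8)
      rw [← hu] at this
      linarith
    have hju : u ^ 3 ≤ √j := by
      refine Real.le_sqrt_of_sq_le ?_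
      rw [← pow_mul, ← Real.log_le_log_iff (by positivity) hj0, Real.log_pow]
      have : Real.log X = 8 * Real.log u := by
        rw [← hu8, Real.log_pow]
        norm_num
      push_cast
      linarith
    have hre : (w / X * j).re = j / X := by
      rw [← Complex.ofReal_natCast, Complex.re_mul_ofReal, re_div_ofReal_eq hw]
      ring
    have h := norm_primePairExpSum_le (s := w / X * j) (by rw [hre]; positivity)
    rw [hre, one_div_div] at h
    have b1 : ‖1 / (j : ℂ) * primePairExpSum (w / X * j)‖ ≤
        8 * X / Real.log X * ((j : ℝ)⁻¹ ^ 2 * √j) := by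
      rw [norm_mul, norm_div, norm_one, Complex.norm_natCast]
      have : X * Real.log X ≤ 8 * (√j * j) := by
        calc X * Real.log X ≤ u ^ 8 * (8 * u) := by rw [hu8]; gcongr
          _ = 8 * (u ^ 3 * (u ^ 3) ^ 2) := by ring
          _ ≤ 8 * (√j * √j ^ 2) := by gcongr
          _ = _ := by rw [hsq]
      calc _ ≤ 1 / (j : ℝ) * (X / j) ^ 2 := by gcongr
        _ = X * (j : ℝ)⁻¹ ^ 3 / Real.log X * (X * Real.log X) := by field_simp
        _ ≤ X * (j : ℝ)⁻¹ ^ 3 / Real.log X * (8 * (√j * j)) := by gcongr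
        _ = _ := by field_simp
    have b2 : ‖1 / (j : ℂ) ^ 2 * (2 * X * Real.log (Real.log X) / (w * Real.log X))‖ ≤
        16 * X / Real.log X * ((j : ℝ)⁻¹ ^ 2 * √j) := by
      rw [norm_mul, norm_div, norm_div, norm_pow, norm_one, Complex.norm_natCast,
        norm_mul, norm_mul, norm_mul, Complex.norm_ofNat, Complex.norm_real, Complex.norm_real,
        Complex.norm_real, Real.norm_of_nonneg hLL0, Real.norm_of_nonneg hL.le,
        Real.norm_of_nonneg hX0.le]
      have : Real.log X ≤ 8 * √j := by
        have : u ≤ u ^ 3 := le_self_pow₀ hu1 (by norm_num)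
        linarith
      calc _ ≤ 1 / (j : ℝ) ^ 2 * (2 * X * (8 * √j) / (1 * Real.log X)) := by
            gcongr
            linarith
        _ = _ := by field_simp; ring
    refine (norm_sub_le _ _).trans ((add_le_add b1 b2).trans ?_)
    have : 0 ≤ C * X / Real.log X * ((j : ℝ)⁻¹ ^ 2 * √j) := by positivity
    have : 0 ≤ X / Real.log X * ((j : ℝ)⁻¹ ^ 2 * √j) := by positivity
    have e1 : (8 * C + 80 + 24) * X / Real.log X * ((j : ℝ)⁻¹ ^ 2 * √j) =
      8 * (C * X / Real.log X * ((j : ℝ)⁻¹ ^ 2 * √j)) +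
      104 * (X / Real.log X * ((j : ℝ)⁻¹ ^ 2 * √j)) := by ring
    have e2 : 8 * X / Real.log X * ((j : ℝ)⁻¹ ^ 2 * √j) =
      8 * (X / Real.log X * ((j : ℝ)⁻¹ ^ 2 * √j)) := by ring
    have e3 : 16 * X / Real.log X * ((j : ℝ)⁻¹ ^ 2 * √j) =
      16 * (X / Real.log X * ((j : ℝ)⁻¹ ^ 2 * √j)) := by ring
    rw [e1, e2, e3]
    linarith

theorem norm_PhiP2C_sub_main_le (D : ℝ) (n : ℕ) : ∃ C : ℝ, 0 ≤ C ∧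
    ∀ (X : ℝ) (w : ℂ), 1 < X → 8 ≤ Real.log X → w.re = 1 → ‖w‖ ≤ D * Real.log X ^ n →
    ‖PhiP2C (Complex.exp (-(w / X))) -
        zeta2 * (2 * X * Real.log (Real.log X) / (w * Real.log X))‖ ≤ C * X / Real.log X := by
  obtain ⟨C, hC, hCb⟩ := norm_primePairExpSum_mul_sub_le D n
  have hsum : Summable fun j : ℕ+ ↦ ((j : ℕ) : ℝ) ^ (-(3 / 2) : ℝ) :=
    (Real.summable_nat_rpow.2 (by norm_num)).comp_injective PNat.coe_injective
  refine ⟨C * ∑' j : ℕ+, ((j : ℕ) : ℝ) ^ (-(3 / 2) : ℝ), mul_nonneg hC (tsum_nonneg fun j ↦ by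
    positivity), fun X w hX hl hw hwD ↦ ?_⟩
  have hX0 : 0 < X := by linarith
  have hs : 0 < (w / X).re := by rw [re_div_ofReal_eq hw]; positivity
  have hm := hasSum_one_div_pnat_sq.mul_right
    (2 * X * Real.log (Real.log X) / (w * Real.log X) : ℂ)
  have hb : ∀ j : ℕ+, ‖1 / ((j : ℕ) : ℂ) * primePairExpSum (w / X * (j : ℕ)) -
      1 / ((j : ℕ) : ℂ) ^ 2 * (2 * X * Real.log (Real.log X) / (w * Real.log X))‖ ≤
      C * X / Real.log X * ((j : ℕ) : ℝ) ^ (-(3 / 2) : ℝ) :=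
    fun j ↦ hCb X w j hX hl hw hwD j.pos
  have hd := Summable.of_norm_bounded (hsum.mul_left (C * X / Real.log X)) hb
  have hT : Summable fun j : ℕ+ ↦ 1 / ((j : ℕ) : ℂ) * primePairExpSum (w / X * (j : ℕ)) := by
    refine (hd.add hm.summable).congr fun j ↦ ?_
    ring
  rw [PhiP2C_exp_neg hs, ← hm.tsum_eq]
  have e : (∑' j : ℕ+, (1 / (j : ℂ)) * primePairExpSum (w / X * (j : ℕ))) =
      ∑' j : ℕ+, 1 / ((j : ℕ) : ℂ) * primePairExpSum (w / X * (j : ℕ)) := rfl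
  rw [e, ← hT.tsum_sub hm.summable]
  refine (tsum_of_norm_bounded (hsum.mul_left (C * X / Real.log X)).hasSum hb).trans_eq ?_
  rw [tsum_mul_left]
  ring

/-- Corollary 7.3 (expansion of `Φ` on the principal major arc `𝔐(1,0)`): for
`|α| ≤ X⁻¹(log X)^A` and `ρ = e^{−1/X}`,
`Φ(ρe(α)) = 2ζ(2) X log log X/((1 − 2πiαX) log X) + O(X log log log log X / log X)`,
with implied constant depending only on `A`. -/
theorem Phi_on_principal_arc (A : ℝ) (hA : 0 < A) :
    ∃ C : ℝ, 0 < C ∧ ∃ X₀ : ℝ,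
      ∀ X : ℝ, X₀ < X →
        ∀ α : ℝ, |α| ≤ (Real.log X) ^ A / X →
          ‖PhiP2C ((Real.exp (-1/X) : ℝ) * eC α) -
              (2 * (zeta2 : ℂ) * (X : ℂ) * (Real.log (Real.log X) : ℂ)) /
                ((1 - 2 * Real.pi * Complex.I * (α : ℂ) * (X : ℂ)) * (Real.log X : ℂ))‖ ≤
            C * X * Real.log (Real.log (Real.log (Real.log X))) / Real.log X := by
  obtain ⟨C, hC, hCb⟩ := norm_PhiP2C_sub_main_le (1 + 2 * π) ⌈A⌉₊
  have hlog := Real.tendsto_log_atTop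
  obtain ⟨X₀, hX₀⟩ := eventually_atTop.1 (((hlog.comp (hlog.comp (hlog.comp hlog))).eventually_ge_atTop
    1).and ((hlog.eventually_ge_atTop 8).and (eventually_gt_atTop 1)))
  refine ⟨C + 1, by linarith, X₀, fun X hX α hα ↦ ?_⟩
  obtain ⟨h4, hl, hX1⟩ := hX₀ X hX.le
  simp only [Function.comp_apply] at h4
  have hX0 : 0 < X := by linarith
  have hL : 0 < Real.log X := by linarith
  set w : ℂ := 1 - 2 * Real.pi * Complex.I * (α : ℂ) * (X : ℂ) with hw
  have hwe : w = 1 + ((-(2 * π * α * X) : ℝ) : ℂ) * Complex.I := by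
    rw [hw]
    push_cast
    ring
  have hre : w.re = 1 := by
    rw [hwe]
    simp only [Complex.add_re, Complex.one_re, Complex.re_ofReal_mul, Complex.I_re, mul_zero,
      add_zero]
  have hnw : ‖w‖ ≤ (1 + 2 * π) * Real.log X ^ ⌈A⌉₊ := by
    rw [hwe]
    refine (norm_add_le _ _).trans ?_
    rw [norm_one, norm_mul, Complex.norm_I, mul_one, Complex.norm_real, norm_neg, Real.norm_eq_abs,
      abs_mul, abs_mul, abs_of_pos Real.two_pi_pos, abs_of_pos hX0]
    have h1 : |α| * X ≤ Real.log X ^ A := by rwa [le_div_iff₀ hX0] at hα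
    have h2 : Real.log X ^ A ≤ Real.log X ^ ⌈A⌉₊ := by
      rw [← Real.rpow_natCast]
      exact Real.rpow_le_rpow_of_exponent_le (by linarith) (Nat.le_ceil A)
    have h3 : 1 ≤ Real.log X ^ ⌈A⌉₊ := one_le_pow₀ (by linarith)
    have h5 : 2 * π * (|α| * X) ≤ 2 * π * Real.log X ^ ⌈A⌉₊ := by
      have := Real.pi_pos
      gcongr
      exact h1.trans h2
    linarith
  have hz : ((Real.exp (-1/X) : ℝ) : ℂ) * eC α = Complex.exp (-(w / X)) := by
    rw [eC, Complex.ofReal_exp, ← Complex.exp_add, hw]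
    congr 1
    have : (X : ℂ) ≠ 0 := Complex.ofReal_ne_zero.2 hX0.ne'
    push_cast
    field_simp
    ring
  have h := hCb X w hX1 hl hre hnw
  rw [hz]
  have e : (2 * (zeta2 : ℂ) * (X : ℂ) * (Real.log (Real.log X) : ℂ)) / (w * (Real.log X : ℂ)) =
      zeta2 * (2 * X * Real.log (Real.log X) / (w * Real.log X)) := by ring
  rw [e]
  refine h.trans ?_
  refine div_le_div_of_nonneg_right ?_ hL.le
  calc C * X = C * X * 1 := (mul_one _).symm
    _ ≤ (C + 1) * X * Real.log (Real.log (Real.log (Real.log X))) := by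
        gcongr
        linarith

end
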